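/- arXiv:1912.01318 — 2 statements merged into one kernel-verified Lean document; each statement's English description precedes it below -/
import Mathlib

section
/- (Young's convolution inequality in Lorentz spaces) Let 1 < p, p₁, p₂ < ∞ and 1 ≤ q, q₁, q₂ ≤ ∞ satisfy 1/p + 1 = 1/p₁ + 1/p₂ and 1/q = 1/q₁ + 1/q₂. Then there is a constant C such that ‖f ∗ g‖_{L^{p,q}(ℝ^d)} ≤ C ‖f‖_{L^{p₁,q₁}(ℝ^d)} ‖g‖_{L^{p₂,q₂}(ℝ^d)}. -/
open MeasureTheory ENNReal

/-- The Lorentz quasi-norm `‖f‖_{L^{p,q}} = ‖ λ · μ({|f| > λ})^{1/p} ‖_{L^q((0,∞), dλ/λ)}`,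
with the usual supremum modification for `q = ∞`. -/
noncomputable def lorentzNorm {α : Type*} [MeasurableSpace α] (μ : Measure α)
    (p : ℝ) (q : ℝ≥0∞) (f : α → ℂ) : ℝ≥0∞ :=
  if q = ⊤ then
    ⨆ (l : ℝ) (_ : 0 < l), ENNReal.ofReal l * (μ {x | l < ‖f x‖}) ^ (1 / p)
  else
    (∫⁻ l in Set.Ioi (0 : ℝ),
        (ENNReal.ofReal l * (μ {x | l < ‖f x‖}) ^ (1 / p)) ^ q.toReal
          * (ENNReal.ofReal l)⁻¹) ^ (1 / q.toReal)

namespace LorentzYoung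

/-- The multiplicative Haar measure `dt/t` on `(0,∞)`, as a measure on `ℝ`. -/
noncomputable def mulHaar : Measure ℝ :=
  (volume.restrict (Set.Ioi 0)).withDensity fun t => (ENNReal.ofReal t)⁻¹

instance : SFinite mulHaar := by unfold mulHaar; infer_instance

/-- The `L^q((0,∞), dt/t)` norm, with a genuine supremum for `q = ∞`. -/
noncomputable def mulNorm (q : ℝ≥0∞) (φ : ℝ → ℝ≥0∞) : ℝ≥0∞ :=
  if q = ⊤ then ⨆ (t : ℝ) (_ : 0 < t), φ t
  else (∫⁻ t, φ t ^ q.toReal ∂mulHaar) ^ (1 / q.toReal)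

theorem lintegral_mulHaar {φ : ℝ → ℝ≥0∞} (hφ : Measurable φ) :
    ∫⁻ t, φ t ∂mulHaar = ∫⁻ t in Set.Ioi 0, φ t * (ENNReal.ofReal t)⁻¹ := by
  unfold mulHaar
  rw [lintegral_withDensity_eq_lintegral_mul _ (by fun_prop) hφ]
  simp only [Pi.mul_apply, mul_comm]

theorem ae_mulHaar_pos : ∀ᵐ t ∂mulHaar, 0 < t :=
  (withDensity_absolutelyContinuous _ _).ae_le (ae_restrict_mem measurableSet_Ioi)

theorem lorentzNorm_eq_mulNorm {α : Type*} [MeasurableSpace α] (μ : Measure α)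
    (p : ℝ) (q : ℝ≥0∞) (f : α → ℂ) :
    lorentzNorm μ p q f =
      mulNorm q fun l => ENNReal.ofReal l * (μ {x | l < ‖f x‖}) ^ (1 / p) := by
  have hd : Measurable fun l : ℝ => μ {x | l < ‖f x‖} :=
    Antitone.measurable fun a b hab => measure_mono fun x hx => hab.trans_lt hx
  have hm : Measurable fun l : ℝ =>
      (ENNReal.ofReal l * (μ {x | l < ‖f x‖}) ^ (1 / p)) ^ q.toReal :=
    (ENNReal.measurable_ofReal.mul (hd.pow_const _)).pow_const _
  unfold lorentzNorm mulNorm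
  rw [lintegral_mulHaar hm]

theorem mulNorm_mono {q : ℝ≥0∞} {φ ψ : ℝ → ℝ≥0∞} (h : ∀ t, 0 < t → φ t ≤ ψ t) :
    mulNorm q φ ≤ mulNorm q ψ := by
  unfold mulNorm
  split_ifs
  · exact iSup₂_mono h
  · gcongr ?_ ^ _
    refine lintegral_mono_ae ?_
    filter_upwards [ae_mulHaar_pos] with t ht
    gcongr
    exact h t ht

theorem one_le_toReal {q : ℝ≥0∞} (hq : 1 ≤ q) (hq' : q ≠ ⊤) : 1 ≤ q.toReal := by
  simpa using ENNReal.toReal_mono hq' hq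

theorem mulNorm_add_le {q : ℝ≥0∞} (hq : 1 ≤ q) {φ ψ : ℝ → ℝ≥0∞} (hφ : Measurable φ)
    (hψ : Measurable ψ) : mulNorm q (fun t => φ t + ψ t) ≤ mulNorm q φ + mulNorm q ψ := by
  unfold mulNorm
  split_ifs with h
  · exact iSup₂_le fun t ht => add_le_add (le_iSup₂_of_le t ht le_rfl) (le_iSup₂_of_le t ht le_rfl)
  · exact ENNReal.lintegral_Lp_add_le hφ.aemeasurable hψ.aemeasurable (one_le_toReal hq h)

theorem mulNorm_const_mul {q : ℝ≥0∞} (hq : 1 ≤ q) (c : ℝ≥0∞) {φ : ℝ → ℝ≥0∞}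
    (hφ : Measurable φ) : mulNorm q (fun t => c * φ t) = c * mulNorm q φ := by
  unfold mulNorm
  split_ifs with h
  · simp only [ENNReal.mul_iSup]
  · have h1 : 0 < q.toReal := zero_lt_one.trans_le (one_le_toReal hq h)
    simp only [ENNReal.mul_rpow_of_nonneg _ _ h1.le]
    rw [lintegral_const_mul _ (by fun_prop), ENNReal.mul_rpow_of_nonneg _ _ (by positivity),
      ← ENNReal.rpow_mul, mul_one_div_cancel h1.ne', ENNReal.rpow_one]

theorem mulNorm_mul_le {q q₁ q₂ : ℝ≥0∞} (hq : 1 ≤ q) (hq₁ : 1 ≤ q₁) (hq₂ : 1 ≤ q₂)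
    (hqe : q⁻¹ = q₁⁻¹ + q₂⁻¹) {φ ψ : ℝ → ℝ≥0∞} (hφ : Measurable φ) (hψ : Measurable ψ) :
    mulNorm q (fun t => φ t * ψ t) ≤ mulNorm q₁ φ * mulNorm q₂ ψ := by
  have key : ∀ {q : ℝ≥0∞}, 1 ≤ q → ∀ {φ ψ : ℝ → ℝ≥0∞}, Measurable ψ →
      mulNorm q (fun t => φ t * ψ t) ≤ mulNorm ⊤ φ * mulNorm q ψ := by
    intro q hq φ ψ hψ
    rw [← mulNorm_const_mul hq _ hψ]
    refine mulNorm_mono fun t ht => ?_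
    gcongr
    simp only [mulNorm, if_true]
    exact le_iSup₂_of_le t ht le_rfl
  by_cases h1 : q₁ = ⊤
  · subst h1
    obtain rfl : q = q₂ := by simpa using hqe
    exact key hq hψ
  by_cases h2 : q₂ = ⊤
  · subst h2
    obtain rfl : q = q₁ := by simpa using hqe
    simpa only [mul_comm] using key hq (φ := ψ) hφ
  have p1 := one_le_toReal hq₁ h1
  have p2 := one_le_toReal hq₂ h2
  have h : q ≠ ⊤ := by
    rintro rfl
    rw [ENNReal.inv_top, eq_comm, add_eq_zero] at hqe
    exact h1 (ENNReal.inv_eq_zero.mp hqe.1)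
  have p0 := one_le_toReal hq h
  have he : 1 / q.toReal = 1 / q₁.toReal + 1 / q₂.toReal := by
    have := congrArg ENNReal.toReal hqe
    rw [ENNReal.toReal_add (by simp; rintro rfl; simp at hq₁)
      (by simp; rintro rfl; simp at hq₂)] at this
    simpa using this
  have hlt : q.toReal < q₁.toReal := by
    rw [← one_div_lt_one_div (by linarith) (by linarith), he]
    have : 0 < 1 / q₂.toReal := by positivity
    linarith
  simp only [mulNorm, h, h1, h2, if_false]
  exact ENNReal.lintegral_Lp_mul_le_Lq_mul_Lr (by linarith) hlt he _ hφ.aemeasurable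
    hψ.aemeasurable

theorem ofReal_mul_lintegral_comp_mul_left {c : ℝ} (hc : 0 < c) (g : ℝ → ℝ≥0∞) :
    ENNReal.ofReal c * ∫⁻ x, g (c * x) = ∫⁻ x, g x := by
  conv_rhs => rw [← Real.smul_map_volume_mul_left hc.ne', lintegral_smul_measure, abs_of_pos hc]
  exact congrArg _ ((Homeomorph.mulLeft₀ c hc.ne').measurableEmbedding.lintegral_map g).symm

theorem lintegral_mulHaar_comp_mul_right {c : ℝ} (hc : 0 < c) {φ : ℝ → ℝ≥0∞}
    (hφ : Measurable φ) : ∫⁻ t, φ (t * c) ∂mulHaar = ∫⁻ t, φ t ∂mulHaar := by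
  rw [lintegral_mulHaar (by fun_prop), lintegral_mulHaar hφ,
    ← lintegral_indicator measurableSet_Ioi, ← lintegral_indicator measurableSet_Ioi,
    ← ofReal_mul_lintegral_comp_mul_left hc
      ((Set.Ioi 0).indicator fun t => φ t * (ENNReal.ofReal t)⁻¹),
    ← lintegral_const_mul' _ _ (by simp)]
  congr 1 with t
  by_cases ht : 0 < t
  · have : 0 < c * t := by positivity
    rw [Set.indicator_of_mem (by exact ht), Set.indicator_of_mem (by exact this),
      ENNReal.ofReal_mul hc.le, ENNReal.mul_inv (by simp) (by simp), mul_comm t c,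
      mul_left_comm, ← mul_assoc (ENNReal.ofReal c),
      ENNReal.mul_inv_cancel (by simpa using hc) (by simp), one_mul]
  · have : ¬ 0 < c * t := fun h => ht (by simpa [hc] using h)
    rw [Set.indicator_of_notMem (by exact ht), Set.indicator_of_notMem (by exact this), mul_zero]

/-- Jensen's inequality for a weighted integral. -/
theorem lintegral_mul_rpow_le {α : Type*} [MeasurableSpace α] {ν : Measure α} {r : ℝ} (hr : 1 ≤ r)
    {k φ : α → ℝ≥0∞} (hk : Measurable k) (hφ : Measurable φ) :
    (∫⁻ x, k x * φ x ∂ν) ^ r ≤ (∫⁻ x, k x ∂ν) ^ (r - 1) * ∫⁻ x, k x * φ x ^ r ∂ν := by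
  have h0 : 0 < r := by linarith
  have := eLpNorm'_le_eLpNorm'_mul_rpow_measure_univ (μ := ν.withDensity k) zero_lt_one hr
    (f := φ) hφ.aestronglyMeasurable
  simp only [eLpNorm', enorm_eq_self, ENNReal.rpow_one, one_div_one] at this
  rw [lintegral_withDensity_eq_lintegral_mul _ hk hφ,
    lintegral_withDensity_eq_lintegral_mul _ hk (by fun_prop),
    withDensity_apply _ MeasurableSet.univ, Measure.restrict_univ] at this
  simp only [Pi.mul_apply] at this
  calc _ ≤ _ := ENNReal.rpow_le_rpow this h0.le
    _ = _ := by
      rw [ENNReal.mul_rpow_of_nonneg _ _ h0.le, ← ENNReal.rpow_mul, ← ENNReal.rpow_mul,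
        one_div_mul_cancel h0.ne', ENNReal.rpow_one, mul_comm]
      congr 2
      field_simp

/-- Minkowski's inequality for averages of dilations. -/
theorem mulNorm_lintegral_dilation_le {q : ℝ≥0∞} (hq : 1 ≤ q) {S : Set ℝ} (hS : MeasurableSet S)
    (hS0 : S ⊆ Set.Ioi 0) {k φ : ℝ → ℝ≥0∞} (hk : Measurable k) (hφ : Measurable φ) :
    mulNorm q (fun t => ∫⁻ x in S, k x * φ (t * x)) ≤ (∫⁻ x in S, k x) * mulNorm q φ := by
  unfold mulNorm
  split_ifs with h
  · refine iSup₂_le fun t ht => ?_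
    rw [← lintegral_mul_const _ hk]
    refine setLIntegral_mono' hS fun x hx => ?_
    gcongr
    exact le_iSup₂_of_le (t * x) (mul_pos ht (hS0 hx)) le_rfl
  · have hr := one_le_toReal hq h
    set r := q.toReal
    have h0 : 0 < r := by linarith
    calc _ ≤ (∫⁻ t, (∫⁻ x in S, k x) ^ (r - 1) *
            (∫⁻ x in S, k x * φ (t * x) ^ r) ∂mulHaar) ^ (1 / r) := by
          gcongr with t
          exact lintegral_mul_rpow_le hr hk (by fun_prop)
      _ = ((∫⁻ x in S, k x) ^ (r - 1) * ((∫⁻ x in S, k x) * ∫⁻ t, φ t ^ r ∂mulHaar)) ^ (1 / r) := by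
          have hm : Measurable (Function.uncurry fun t x : ℝ => k x * φ (t * x) ^ r) := by
            unfold Function.uncurry
            fun_prop
          have hm' : Measurable fun t : ℝ => ∫⁻ x in S, k x * φ (t * x) ^ r :=
            hm.lintegral_prod_right'
          rw [lintegral_const_mul _ hm',
            lintegral_lintegral_swap hm.aemeasurable, ← lintegral_mul_const _ hk]
          congr 2
          refine setLIntegral_congr_fun hS fun x hx => ?_
          rw [lintegral_const_mul _ (by fun_prop),
            lintegral_mulHaar_comp_mul_right (hS0 hx) (φ := fun t => φ t ^ r) (by fun_prop)]
      _ = _ := by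
          rw [← mul_assoc]
          conv_lhs => enter [1, 1, 2]; rw [← ENNReal.rpow_one (∫⁻ x in S, k x)]
          rw [← ENNReal.rpow_add_of_nonneg _ _ (by linarith) zero_le_one, sub_add_cancel,
            ENNReal.mul_rpow_of_nonneg _ _ (by positivity), ← ENNReal.rpow_mul,
            mul_one_div_cancel h0.ne', ENNReal.rpow_one]

/-- The indicator of the relation `a < b`. -/
noncomputable def ltInd (a b : ℝ≥0∞) : ℝ≥0∞ := if a < b then 1 else 0

@[fun_prop]
theorem measurable_ltInd {α : Type*} [MeasurableSpace α] {f g : α → ℝ≥0∞} (hf : Measurable f)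
    (hg : Measurable g) : Measurable fun x => ltInd (f x) (g x) :=
  Measurable.ite (measurableSet_lt hf hg) measurable_const measurable_const

theorem ltInd_le_one (a b : ℝ≥0∞) : ltInd a b ≤ 1 := by
  unfold ltInd
  split_ifs <;> simp

theorem ltInd_of_lt {a b : ℝ≥0∞} (h : a < b) : ltInd a b = 1 := if_pos h

theorem ltInd_of_le {a b : ℝ≥0∞} (h : b ≤ a) : ltInd a b = 0 := if_neg h.not_gt

theorem lintegral_ltInd_const {α : Type*} [MeasurableSpace α] (μ : Measure α) {f : α → ℝ≥0∞}
    (hf : Measurable f) (c : ℝ≥0∞) : ∫⁻ x, ltInd c (f x) ∂μ = μ {x | c < f x} := by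
  rw [← lintegral_indicator_one (measurableSet_lt measurable_const hf)]
  congr 1 with x
  simp [ltInd, Set.indicator]

theorem setLIntegral_Ioc_rpow {b M : ℝ} (hb : 0 < b) (hM : 0 ≤ M) :
    ∫⁻ s in Set.Ioc 0 M, ENNReal.ofReal s ^ (b - 1) = ENNReal.ofReal (M ^ b / b) := by
  have hi := (intervalIntegrable_iff_integrableOn_Ioc_of_le hM).mp
    (intervalIntegral.intervalIntegrable_rpow' (r := b - 1) (by linarith))
  have hv := integral_rpow (a := 0) (b := M) (r := b - 1) (Or.inl (by linarith))
  rw [sub_add_cancel, Real.zero_rpow hb.ne', sub_zero, intervalIntegral.integral_of_le hM] at hv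
  rw [← hv, ofReal_integral_eq_lintegral_ofReal hi]
  · exact setLIntegral_congr_fun measurableSet_Ioc fun x hx => ENNReal.ofReal_rpow_of_pos hx.1
  · filter_upwards [ae_restrict_mem measurableSet_Ioc] with x hx
    exact Real.rpow_nonneg hx.1.le _

theorem ofReal_rpow_mul_inv {b s : ℝ} (hs : 0 < s) :
    ENNReal.ofReal s ^ b * (ENNReal.ofReal s)⁻¹ = ENNReal.ofReal s ^ (b - 1) := by
  rw [ENNReal.rpow_sub _ _ (by simpa using hs) (by simp), ENNReal.rpow_one, div_eq_mul_inv]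

theorem lintegral_ltInd_rpow_mulHaar {b : ℝ} (hb : 0 < b) (m : ℝ≥0∞) :
    ENNReal.ofReal b * ∫⁻ s, ltInd (ENNReal.ofReal s) m * ENNReal.ofReal s ^ b ∂mulHaar
      = m ^ b := by
  have key : ∀ M : ℝ, 0 ≤ M → ENNReal.ofReal b *
      ∫⁻ s, ltInd (ENNReal.ofReal s) (ENNReal.ofReal M) * ENNReal.ofReal s ^ b ∂mulHaar
      = ENNReal.ofReal M ^ b := by
    intro M hM
    rw [lintegral_mulHaar (by fun_prop), ENNReal.ofReal_rpow_of_nonneg hM hb.le]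
    have h1 : ∫⁻ s in Set.Ioi 0, ltInd (ENNReal.ofReal s) (ENNReal.ofReal M) *
        ENNReal.ofReal s ^ b * (ENNReal.ofReal s)⁻¹ =
        ∫⁻ s in Set.Ioc 0 M, ENNReal.ofReal s ^ (b - 1) := by
      rw [setLIntegral_congr Ioo_ae_eq_Ioc.symm, ← lintegral_indicator measurableSet_Ioi,
        ← lintegral_indicator measurableSet_Ioo]
      congr 1 with s
      by_cases hs : 0 < s
      · rw [Set.indicator_of_mem (Set.mem_Ioi.mpr hs), mul_assoc, ofReal_rpow_mul_inv hs]
        by_cases hsM : s < M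
        · rw [Set.indicator_of_mem (Set.mem_Ioo.mpr ⟨hs, hsM⟩),
            ltInd_of_lt ((ENNReal.ofReal_lt_ofReal_iff_of_nonneg hs.le).mpr hsM), one_mul]
        · rw [Set.indicator_of_notMem (fun h => hsM h.2),
            ltInd_of_le (ENNReal.ofReal_le_ofReal (not_lt.mp hsM)), zero_mul]
      · rw [Set.indicator_of_notMem (Set.notMem_Ioi.mpr (not_lt.mp hs)),
          Set.indicator_of_notMem (fun h => hs h.1)]
    rw [h1, setLIntegral_Ioc_rpow hb hM, ← ENNReal.ofReal_mul hb.le, mul_div_cancel₀ _ hb.ne']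
  induction m with
  | coe m => simpa using key m m.2
  | top =>
    rw [ENNReal.top_rpow_of_pos hb]
    refine ENNReal.eq_top_of_forall_nnreal_le fun r => ?_
    have := key ((r : ℝ) ^ (1 / b)) (by positivity)
    rw [ENNReal.ofReal_rpow_of_nonneg (by positivity) hb.le, ← Real.rpow_mul (NNReal.coe_nonneg r),
      one_div_mul_cancel hb.ne', Real.rpow_one, ENNReal.ofReal_coe_nnreal] at this
    rw [← this]
    gcongr with s
    rw [ltInd_of_lt ENNReal.ofReal_lt_top]
    exact ltInd_le_one _ _

theorem ae_mulHaar_ne (x : ℝ) : ∀ᵐ t ∂mulHaar, t ≠ x :=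
  (withDensity_absolutelyContinuous _ _).ae_le
    (Measure.absolutelyContinuous_of_le Measure.restrict_le_self |>.ae_le
      (Measure.ae_ne volume x))

theorem lintegral_mul_rpow_le_of_rel {U V : ℝ → ℝ≥0∞} (hU : Measurable U)
    {a b : ℝ} (ha : 0 < a) (hb : 0 < b)
    (h : ∀ s t : ℝ, 0 < s → 0 < t → ENNReal.ofReal s < U t → ENNReal.ofReal t ≤ V s) :
    ENNReal.ofReal a * ∫⁻ t, ENNReal.ofReal t ^ a * U t ^ b ∂mulHaar ≤
      ENNReal.ofReal b * ∫⁻ s, ENNReal.ofReal s ^ b * V s ^ a ∂mulHaar := by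
  simp_rw [← lintegral_ltInd_rpow_mulHaar hb (U _), ← lintegral_ltInd_rpow_mulHaar ha (V _)]
  simp_rw [mul_left_comm _ (ENNReal.ofReal _) (∫⁻ _, _ ∂_)]
  rw [lintegral_const_mul' _ _ (by simp), lintegral_const_mul' _ _ (by simp), mul_left_comm]
  gcongr _ * (_ * ?_)
  have e1 : ∀ t : ℝ, ENNReal.ofReal t ^ a * ∫⁻ s, ltInd (ENNReal.ofReal s) (U t) *
      ENNReal.ofReal s ^ b ∂mulHaar = ∫⁻ s, ENNReal.ofReal t ^ a *
        (ltInd (ENNReal.ofReal s) (U t) * ENNReal.ofReal s ^ b) ∂mulHaar := fun t =>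
    (lintegral_const_mul _ (by fun_prop)).symm
  have e2 : ∀ s : ℝ, ENNReal.ofReal s ^ b * ∫⁻ t, ltInd (ENNReal.ofReal t) (V s) *
      ENNReal.ofReal t ^ a ∂mulHaar = ∫⁻ t, ENNReal.ofReal s ^ b *
        (ltInd (ENNReal.ofReal t) (V s) * ENNReal.ofReal t ^ a) ∂mulHaar := fun s =>
    (lintegral_const_mul _ (by fun_prop)).symm
  simp_rw [e1, e2]
  rw [lintegral_lintegral_swap (Measurable.aemeasurable (by unfold Function.uncurry; fun_prop))]
  refine lintegral_mono_ae ?_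
  filter_upwards [ae_mulHaar_pos] with s hs
  refine lintegral_mono_ae ?_
  filter_upwards [ae_mulHaar_pos, ae_mulHaar_ne (V s).toReal] with t ht hne
  by_cases hst : ENNReal.ofReal s < U t
  · have hlt : ENNReal.ofReal t < V s := by
      refine lt_of_le_of_ne (h s t hs ht hst) fun heq => hne ?_
      rw [← heq, ENNReal.toReal_ofReal ht.le]
    rw [ltInd_of_lt hst, ltInd_of_lt hlt]
    simp only [one_mul]
    rw [mul_comm]
  · rw [ltInd_of_le (not_lt.mp hst)]
    simp

/-- If the subgraph of `U` lies in the transposed subgraph of `V`, then weighted norms of `U` are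
controlled by the corresponding weighted norms of `V`. -/
theorem mulNorm_le_of_rel {q : ℝ≥0∞} (hq : 1 ≤ q) {a b : ℝ} (ha : 0 < a) (hb : 0 < b) :
    ∃ C : ℝ≥0∞, C ≠ ⊤ ∧ ∀ U V : ℝ → ℝ≥0∞, Measurable U →
      (∀ s t : ℝ, 0 < s → 0 < t → ENNReal.ofReal s < U t → ENNReal.ofReal t ≤ V s) →
      mulNorm q (fun t => ENNReal.ofReal t ^ a * U t ^ b) ≤
        C * mulNorm q (fun s => ENNReal.ofReal s ^ b * V s ^ a) := by
  by_cases hq' : q = ⊤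
  · refine ⟨1, by simp, fun U V _ h => ?_⟩
    simp only [mulNorm, hq', if_true, one_mul]
    refine iSup₂_le fun t ht => ?_
    set X := ⨆ (s : ℝ) (_ : 0 < s), ENNReal.ofReal s ^ b * V s ^ a
    have ht0 : ENNReal.ofReal t ^ a ≠ 0 :=
      (ENNReal.rpow_pos (by simpa using ht) (by simp)).ne'
    have ht1 : ENNReal.ofReal t ^ a ≠ ⊤ := by simp [ha.le]
    rw [mul_comm, ← ENNReal.le_div_iff_mul_le (.inl ht0) (.inl ht1),
      ← ENNReal.le_rpow_inv_iff hb]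
    refine le_of_forall_lt_imp_le_of_dense fun c hc => ?_
    rw [ENNReal.le_rpow_inv_iff hb, ENNReal.le_div_iff_mul_le (.inl ht0) (.inl ht1)]
    lift c to NNReal using hc.ne_top
    rcases eq_or_ne c 0 with rfl | hc0
    · simp [hb]
    · rw [← ENNReal.ofReal_coe_nnreal] at hc ⊢
      have hc' : 0 < (c : ℝ) := by positivity
      refine le_trans ?_ (le_iSup₂_of_le (c : ℝ) hc' le_rfl)
      gcongr
      exact h c t hc' ht hc
  · have hr := one_le_toReal hq hq'
    set r := q.toReal with hrdef
    have h0 : 0 < r := by linarith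
    refine ⟨(ENNReal.ofReal (b / a)) ^ (1 / r), by simp [h0.le], fun U V hU h => ?_⟩
    simp only [mulNorm, hq', if_false, ← hrdef]
    rw [← ENNReal.mul_rpow_of_nonneg _ _ (by positivity)]
    gcongr
    have := lintegral_mul_rpow_le_of_rel hU (mul_pos ha h0) (mul_pos hb h0) h
    simp only [ENNReal.mul_rpow_of_nonneg _ _ h0.le, ← ENNReal.rpow_mul]
    rw [ENNReal.ofReal_div_of_pos ha, ENNReal.mul_comm_div, ← mul_div_assoc,
      ENNReal.le_div_iff_mul_le (by simp [ha]) (by simp)]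
    rw [ENNReal.ofReal_mul ha.le, ENNReal.ofReal_mul hb.le, mul_comm _ (ENNReal.ofReal r),
      mul_comm _ (ENNReal.ofReal r), mul_assoc, mul_assoc,
      ENNReal.mul_le_mul_iff_right (by simp [h0]) (by simp), mul_comm] at this
    exact this

/-- The decreasing rearrangement associated with a distribution function `d`. -/
noncomputable def rearr (d : ℝ → ℝ≥0∞) (v : ℝ) : ℝ≥0∞ :=
  ∫⁻ s in Set.Ioi (0 : ℝ), ltInd (ENNReal.ofReal v) (d s)

theorem measurable_rearr {d : ℝ → ℝ≥0∞} (hd : Measurable d) : Measurable (rearr d) := by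
  have : Measurable (Function.uncurry fun v s : ℝ => ltInd (ENNReal.ofReal v) (d s)) := by
    unfold Function.uncurry
    fun_prop
  exact this.lintegral_prod_right'

theorem lt_of_lt_rearr {d : ℝ → ℝ≥0∞} (hd : Antitone d) {s t : ℝ}
    (h : ENNReal.ofReal s < rearr d t) : ENNReal.ofReal t < d s := by
  contrapose! h
  calc rearr d t ≤ ∫⁻ x in Set.Ioi 0, (Set.Iio s).indicator 1 x := by
        refine lintegral_mono fun x => ?_
        by_cases hx : x < s
        · rw [Set.indicator_of_mem (Set.mem_Iio.mpr hx)]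
          exact ltInd_le_one _ _
        · rw [ltInd_of_le ((hd (not_lt.mp hx)).trans h)]
          exact zero_le
    _ = ENNReal.ofReal s := by
        rw [lintegral_indicator_one measurableSet_Iio, Measure.restrict_apply measurableSet_Iio,
          Set.Iio_inter_Ioi, Real.volume_Ioo, sub_zero]

theorem setLIntegral_Ioi_ltInd (m : ℝ≥0∞) :
    ∫⁻ v in Set.Ioi (0 : ℝ), ltInd (ENNReal.ofReal v) m = m := by
  have := lintegral_ltInd_rpow_mulHaar one_pos m
  rw [lintegral_mulHaar (by fun_prop), ENNReal.ofReal_one, one_mul, ENNReal.rpow_one] at this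
  refine Eq.trans (setLIntegral_congr_fun measurableSet_Ioi fun v hv => ?_) this
  rw [mul_assoc, ofReal_rpow_mul_inv hv, sub_self, ENNReal.rpow_zero, mul_one]

theorem min_mul_le {t : ℝ} (ht : 0 ≤ t) (a b : ℝ≥0∞) :
    min (a * b) (min (ENNReal.ofReal t * a) (ENNReal.ofReal t * b)) ≤
      (∫⁻ v in Set.Ioc 0 t, ltInd (ENNReal.ofReal v) a) *
        (∫⁻ v in Set.Ioc 0 t, ltInd (ENNReal.ofReal v) b) +
      ENNReal.ofReal t *
        ∫⁻ v in Set.Ioi t, ltInd (ENNReal.ofReal v) a * ltInd (ENNReal.ofReal v) b := by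
  have hsplit : ∀ m, (∫⁻ v in Set.Ioc 0 t, ltInd (ENNReal.ofReal v) m) +
      (∫⁻ v in Set.Ioi t, ltInd (ENNReal.ofReal v) m) = m := fun m => by
    rw [← lintegral_union measurableSet_Ioi (Set.Ioc_disjoint_Ioi le_rfl),
      Set.Ioc_union_Ioi_eq_Ioi ht, setLIntegral_Ioi_ltInd]
  have hsmall : ∀ m ≤ ENNReal.ofReal t, ∫⁻ v in Set.Ioc 0 t, ltInd (ENNReal.ofReal v) m = m := by
    intro m hm
    conv_rhs => rw [← hsplit m]
    rw [setLIntegral_congr_fun (g := fun _ => 0) measurableSet_Ioi, lintegral_zero, add_zero]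
    exact fun v hv => ltInd_of_le (hm.trans (ENNReal.ofReal_le_ofReal (le_of_lt hv)))
  have hle : ∀ m, ∫⁻ v in Set.Ioc 0 t, ltInd (ENNReal.ofReal v) m ≤ ENNReal.ofReal t := by
    intro m
    calc _ ≤ ∫⁻ v in Set.Ioc 0 t, 1 := by
          gcongr
          exact ltInd_le_one _ _
      _ = _ := by simp
  have hlarge : ∀ m, ENNReal.ofReal t < m →
      ∫⁻ v in Set.Ioc 0 t, ltInd (ENNReal.ofReal v) m = ENNReal.ofReal t := by
    intro m hm
    rw [setLIntegral_congr_fun (g := fun _ => 1) measurableSet_Ioc]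
    · simp
    · exact fun v hv => ltInd_of_lt ((ENNReal.ofReal_le_ofReal hv.2).trans_lt hm)
  rcases le_or_gt a (ENNReal.ofReal t) with ha | ha
  · refine le_add_right ?_
    rw [hsmall a ha]
    rcases le_or_gt b (ENNReal.ofReal t) with hb | hb
    · rw [hsmall b hb]
      exact min_le_left _ _
    · rw [hlarge b hb, mul_comm a (ENNReal.ofReal t)]
      exact (min_le_right _ _).trans (min_le_left _ _)
  · rcases le_or_gt b (ENNReal.ofReal t) with hb | hb
    · refine le_add_right ?_
      rw [hlarge a ha, hsmall b hb]
      exact (min_le_right _ _).trans (min_le_right _ _)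
    · rw [hlarge a ha, hlarge b hb, ← mul_add]
      have hmin : ∀ v, ltInd v a * ltInd v b = ltInd v (min a b) := by
        intro v
        simp only [ltInd, lt_min_iff]
        split_ifs <;> simp_all
      simp only [hmin]
      calc _ ≤ ENNReal.ofReal t * min a b := by
            refine (min_le_right _ _).trans ?_
            rcases le_total a b with hab | hab <;> simp [hab]
        _ ≤ _ := by
            gcongr
            conv_lhs => rw [← hsplit (min a b)]
            gcongr
            exact hle _

theorem antitone_distribution {α : Type*} [MeasurableSpace α] (μ : Measure α) (F : α → ℝ≥0∞) :
    Antitone fun s : ℝ => μ {x | ENNReal.ofReal s < F x} := fun _ _ hab =>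
  measure_mono fun _ hx => (ENNReal.ofReal_le_ofReal hab).trans_lt hx

section Convolution

variable {G : Type*} [AddCommGroup G] [MeasurableSpace G] [MeasurableAdd₂ G] [MeasurableNeg G]
  [MeasurableSub₂ G] {μ : Measure G} [SigmaFinite μ] [μ.IsAddLeftInvariant] [μ.IsNegInvariant]

theorem setLIntegral_conv_le {α β : G → ℝ≥0∞} (hα : Measurable α) (hβ : Measurable β)
    (hα1 : ∀ x, α x ≤ 1) (hβ1 : ∀ x, β x ≤ 1) (E : Set G) :
    ∫⁻ x in E, ∫⁻ y, α (x - y) * β y ∂μ ∂μ ≤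
      min ((∫⁻ x, α x ∂μ) * ∫⁻ x, β x ∂μ)
        (min (μ E * ∫⁻ x, α x ∂μ) (μ E * ∫⁻ x, β x ∂μ)) := by
  refine le_min ?_ (le_min ?_ ?_)
  · calc _ ≤ ∫⁻ x, ∫⁻ y, α (x - y) * β y ∂μ ∂μ := setLIntegral_le_lintegral _ _
      _ = ∫⁻ y, ∫⁻ x, α (x - y) * β y ∂μ ∂μ :=
          lintegral_lintegral_swap
            (Measurable.aemeasurable (by unfold Function.uncurry; fun_prop))
      _ = ∫⁻ y, (∫⁻ x, α x ∂μ) * β y ∂μ := by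
          congr 1 with y
          rw [lintegral_mul_const _ (by fun_prop), lintegral_sub_right_eq_self α y]
      _ = _ := lintegral_const_mul _ hβ
  · calc _ ≤ ∫⁻ x in E, ∫⁻ y, α (x - y) ∂μ ∂μ := by
          gcongr with x y
          exact mul_le_of_le_one_right' (hβ1 y)
      _ = _ := by
          simp_rw [lintegral_sub_left_eq_self α]
          simp [mul_comm]
  · calc _ ≤ ∫⁻ x in E, ∫⁻ y, β y ∂μ ∂μ := by
          gcongr with x y
          exact mul_le_of_le_one_left' (hα1 _)
      _ = _ := by simp [mul_comm]

theorem mul_min_mul_le {τ e a b : ℝ≥0∞} (h : τ ≤ e) :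
    τ * min (a * b) (min (e * a) (e * b)) ≤ e * min (a * b) (min (τ * a) (τ * b)) := by
  have key : ∀ x y z : ℝ≥0∞, ∀ c, c * min x (min y z) = min (c * x) (min (c * y) (c * z)) := by
    intro x y z c
    rw [mul_min, mul_min]
  rw [key, key]
  refine min_le_min (by gcongr) (min_le_min ?_ ?_) <;> rw [mul_left_comm]

/-- O'Neil's inequality: the rearrangement of `F ∗ H` is controlled by those of `F` and `H`. -/
theorem mul_le_of_lt_measure_conv {F H : G → ℝ≥0∞} (hF : Measurable F) (hH : Measurable H)
    {t : ℝ} (ht : 0 < t) {l : ℝ≥0∞}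
    (hl : ENNReal.ofReal t < μ {x | l < ∫⁻ y, F (x - y) * H y ∂μ}) :
    l * ENNReal.ofReal t ≤
      (∫⁻ v in Set.Ioc 0 t, rearr (fun s => μ {x | ENNReal.ofReal s < F x}) v) *
        (∫⁻ v in Set.Ioc 0 t, rearr (fun s => μ {x | ENNReal.ofReal s < H x}) v) +
      ENNReal.ofReal t * ∫⁻ v in Set.Ioi t,
        rearr (fun s => μ {x | ENNReal.ofReal s < F x}) v *
          rearr (fun s => μ {x | ENNReal.ofReal s < H x}) v := by
  set dF : ℝ → ℝ≥0∞ := fun s => μ {x | ENNReal.ofReal s < F x}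
  set dH : ℝ → ℝ≥0∞ := fun s => μ {x | ENNReal.ofReal s < H x}
  have mF : Measurable dF := (antitone_distribution μ F).measurable
  have mH : Measurable dH := (antitone_distribution μ H).measurable
  set τ := ENNReal.ofReal t with hτ
  set ν : Measure ℝ := volume.restrict (Set.Ioi 0)
  have mconv : Measurable fun x => ∫⁻ y, F (x - y) * H y ∂μ := by
    have : Measurable (Function.uncurry fun x y : G => F (x - y) * H y) := by
      unfold Function.uncurry
      fun_prop
    exact this.lintegral_prod_right'
  obtain ⟨E, hE, hEs, hτE, hEtop⟩ :=
    Measure.exists_subset_measure_lt_top (measurableSet_lt measurable_const mconv) hl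
  have hτ0 : 0 < τ := by simpa [hτ] using ht
  have hlayer : ∫⁻ x in E, ∫⁻ y, F (x - y) * H y ∂μ ∂μ ≤
      ∫⁻ w, min (dF w.1 * dH w.2) (min (μ E * dF w.1) (μ E * dH w.2)) ∂(ν.prod ν) := by
    have e1 : ∀ x y, F (x - y) * H y = ∫⁻ w, ltInd (ENNReal.ofReal w.1) (F (x - y)) *
        ltInd (ENNReal.ofReal w.2) (H y) ∂(ν.prod ν) := by
      intro x y
      rw [lintegral_prod_mul (f := fun s => ltInd (ENNReal.ofReal s) (F (x - y)))
        (g := fun s => ltInd (ENNReal.ofReal s) (H y))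
        (Measurable.aemeasurable (by fun_prop)) (Measurable.aemeasurable (by fun_prop)),
        setLIntegral_Ioi_ltInd, setLIntegral_Ioi_ltInd]
    have m3 : Measurable fun z : (G × G) × (ℝ × ℝ) =>
        ltInd (ENNReal.ofReal z.2.1) (F (z.1.1 - z.1.2)) *
          ltInd (ENNReal.ofReal z.2.2) (H z.1.2) := by fun_prop
    calc _ = ∫⁻ z, F (z.1 - z.2) * H z.2 ∂((μ.restrict E).prod μ) :=
          (lintegral_prod _ (Measurable.aemeasurable (by fun_prop))).symm
      _ = ∫⁻ z, ∫⁻ w, ltInd (ENNReal.ofReal w.1) (F (z.1 - z.2)) *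
            ltInd (ENNReal.ofReal w.2) (H z.2) ∂(ν.prod ν) ∂((μ.restrict E).prod μ) := by
          simp_rw [← e1]
      _ = ∫⁻ w, ∫⁻ z, ltInd (ENNReal.ofReal w.1) (F (z.1 - z.2)) *
            ltInd (ENNReal.ofReal w.2) (H z.2) ∂((μ.restrict E).prod μ) ∂(ν.prod ν) :=
          lintegral_lintegral_swap m3.aemeasurable
      _ ≤ _ := by
          gcongr with w
          rw [lintegral_prod _ (Measurable.aemeasurable (by fun_prop))]
          refine (setLIntegral_conv_le (α := fun z => ltInd (ENNReal.ofReal w.1) (F z))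
            (β := fun z => ltInd (ENNReal.ofReal w.2) (H z)) (by fun_prop) (by fun_prop)
            (fun _ => ltInd_le_one _ _) (fun _ => ltInd_le_one _ _) E).trans_eq ?_
          rw [lintegral_ltInd_const μ hF, lintegral_ltInd_const μ hH]
  have hlE : l * μ E ≤ ∫⁻ x in E, ∫⁻ y, F (x - y) * H y ∂μ ∂μ := by
    rw [← setLIntegral_const]
    exact setLIntegral_mono' hE fun x hx => (hEs hx).le
  have hcancel : l * τ ≤ ∫⁻ w, min (dF w.1 * dH w.2) (min (τ * dF w.1) (τ * dH w.2))
      ∂(ν.prod ν) := by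
    rw [← ENNReal.mul_le_mul_iff_right (hτ0.trans hτE).ne' hEtop.ne]
    calc μ E * (l * τ) = τ * (l * μ E) := by ring
      _ ≤ τ * _ := mul_le_mul_right (hlE.trans hlayer) _
      _ = ∫⁻ w, τ * min (dF w.1 * dH w.2) (min (μ E * dF w.1) (μ E * dH w.2)) ∂(ν.prod ν) :=
          (lintegral_const_mul _ (by fun_prop)).symm
      _ ≤ ∫⁻ w, μ E * min (dF w.1 * dH w.2) (min (τ * dF w.1) (τ * dH w.2)) ∂(ν.prod ν) := by
          refine lintegral_mono fun w => ?_
          exact mul_min_mul_le hτE.le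
      _ = _ := lintegral_const_mul _ (by fun_prop)
  refine hcancel.trans ?_
  have mI : ∀ {d : ℝ → ℝ≥0∞}, Measurable d →
      Measurable fun s => ∫⁻ v in Set.Ioc 0 t, ltInd (ENNReal.ofReal v) (d s) := by
    intro d hd
    have : Measurable (Function.uncurry fun s v : ℝ => ltInd (ENNReal.ofReal v) (d s)) := by
      unfold Function.uncurry
      fun_prop
    exact this.lintegral_prod_right'
  have hI : ∀ {d : ℝ → ℝ≥0∞}, Measurable d →
      ∫⁻ s, (∫⁻ v in Set.Ioc 0 t, ltInd (ENNReal.ofReal v) (d s)) ∂ν =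
        ∫⁻ v in Set.Ioc 0 t, rearr d v := by
    intro d hd
    have hm : Measurable (Function.uncurry fun s v : ℝ => ltInd (ENNReal.ofReal v) (d s)) := by
      unfold Function.uncurry
      fun_prop
    exact lintegral_lintegral_swap hm.aemeasurable
  have hJ : ∫⁻ w, (∫⁻ v in Set.Ioi t, ltInd (ENNReal.ofReal v) (dF w.1) *
      ltInd (ENNReal.ofReal v) (dH w.2)) ∂(ν.prod ν) =
        ∫⁻ v in Set.Ioi t, rearr dF v * rearr dH v := by
    rw [lintegral_lintegral_swap
      (Measurable.aemeasurable (by unfold Function.uncurry; fun_prop))]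
    congr 1 with v
    exact lintegral_prod_mul (f := fun s => ltInd (ENNReal.ofReal v) (dF s))
      (g := fun s => ltInd (ENNReal.ofReal v) (dH s))
      (Measurable.aemeasurable (by fun_prop)) (Measurable.aemeasurable (by fun_prop))
  have mIF : Measurable fun w : ℝ × ℝ =>
      (∫⁻ v in Set.Ioc 0 t, ltInd (ENNReal.ofReal v) (dF w.1)) *
        ∫⁻ v in Set.Ioc 0 t, ltInd (ENNReal.ofReal v) (dH w.2) :=
    ((mI mF).comp measurable_fst).mul ((mI mH).comp measurable_snd)
  calc _ ≤ ∫⁻ w, (∫⁻ v in Set.Ioc 0 t, ltInd (ENNReal.ofReal v) (dF w.1)) *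
        (∫⁻ v in Set.Ioc 0 t, ltInd (ENNReal.ofReal v) (dH w.2)) +
        τ * (∫⁻ v in Set.Ioi t, ltInd (ENNReal.ofReal v) (dF w.1) *
          ltInd (ENNReal.ofReal v) (dH w.2)) ∂(ν.prod ν) := by
        gcongr with w
        exact min_mul_le ht.le _ _
    _ = _ := by
        rw [lintegral_add_left mIF,
          lintegral_const_mul' _ _ (by simp [hτ]), hJ,
          lintegral_prod_mul (mI mF).aemeasurable (mI mH).aemeasurable, hI mF, hI mH]

end Convolution

theorem setLIntegral_eq_ofReal_mul_comp {t : ℝ} (ht : 0 < t) {S : Set ℝ} (hS : MeasurableSet S)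
    (g : ℝ → ℝ≥0∞) :
    ∫⁻ v in S, g v = ENNReal.ofReal t * ∫⁻ x in (fun x => t * x) ⁻¹' S, g (t * x) := by
  rw [← lintegral_indicator hS, ← ofReal_mul_lintegral_comp_mul_left ht,
    ← lintegral_indicator (measurable_const_mul t hS)]
  rfl

theorem rpow_mul_setLIntegral_dilation {a t : ℝ} (ht : 0 < t) {S : Set ℝ} (hS : MeasurableSet S)
    (hS0 : S ⊆ Set.Ioi 0) (R : ℝ → ℝ≥0∞) :
    ENNReal.ofReal t ^ a * ∫⁻ x in S, R (t * x) =
      ∫⁻ x in S, ENNReal.ofReal x ^ (-a) * (ENNReal.ofReal (t * x) ^ a * R (t * x)) := by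
  rw [← lintegral_const_mul' _ _ (ENNReal.rpow_ne_top_of_ne_zero (by simpa using ht) (by simp))]
  refine setLIntegral_congr_fun hS fun x hx => ?_
  have hx0 : 0 < x := hS0 hx
  have h1 : ENNReal.ofReal x ^ a ≠ 0 := (ENNReal.rpow_pos (by simpa using hx0) (by simp)).ne'
  have h2 : ENNReal.ofReal x ^ a ≠ ⊤ :=
    ENNReal.rpow_ne_top_of_ne_zero (by simpa using hx0) (by simp)
  rw [ENNReal.ofReal_mul ht.le, ENNReal.mul_rpow_of_ne_top (by simp) (by simp), ENNReal.rpow_neg,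
    show ∀ u v w z : ℝ≥0∞, w * (u * v * z) = w * v * (u * z) from fun _ _ _ _ => by ring,
    ENNReal.inv_mul_cancel h1 h2, one_mul]

/-- The bilinear Hardy-type operator appearing in O'Neil's inequality. -/
noncomputable def oneil (R₁ R₂ : ℝ → ℝ≥0∞) (t : ℝ) : ℝ≥0∞ :=
  ENNReal.ofReal t * ((∫⁻ x in Set.Ioc 0 1, R₁ (t * x)) * ∫⁻ x in Set.Ioc 0 1, R₂ (t * x)) +
    ENNReal.ofReal t * ∫⁻ x in Set.Ioi 1, R₁ (t * x) * R₂ (t * x)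

theorem measurable_setLIntegral_dilation {k φ : ℝ → ℝ≥0∞} (hk : Measurable k) (hφ : Measurable φ)
    (S : Set ℝ) : Measurable fun t => ∫⁻ x in S, k x * φ (t * x) := by
  have : Measurable (Function.uncurry fun t x : ℝ => k x * φ (t * x)) := by
    unfold Function.uncurry
    fun_prop
  exact this.lintegral_prod_right'

theorem mulNorm_oneil_le {p p₁ p₂ : ℝ} (hp : 1 < p) (hp₁ : 1 < p₁) (hp₂ : 1 < p₂)
    {q q₁ q₂ : ℝ≥0∞} (hq : 1 ≤ q) (hq₁ : 1 ≤ q₁) (hq₂ : 1 ≤ q₂)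
    (hpe : 1 / p + 1 = 1 / p₁ + 1 / p₂) (hqe : q⁻¹ = q₁⁻¹ + q₂⁻¹) :
    ∃ C : ℝ≥0∞, C ≠ ⊤ ∧ ∀ R₁ R₂ : ℝ → ℝ≥0∞, Measurable R₁ → Measurable R₂ →
      mulNorm q (fun t => ENNReal.ofReal t ^ (1 / p) * oneil R₁ R₂ t) ≤
        C * (mulNorm q₁ (fun t => ENNReal.ofReal t ^ (1 / p₁) * R₁ t) *
          mulNorm q₂ (fun t => ENNReal.ofReal t ^ (1 / p₂) * R₂ t)) := by
  have hIoc : Set.Ioc (0 : ℝ) 1 ⊆ Set.Ioi 0 := fun x hx => hx.1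
  have hIoi : Set.Ioi (1 : ℝ) ⊆ Set.Ioi 0 := fun x hx => one_pos.trans (Set.mem_Ioi.mp hx)
  have hKfin : ∀ r : ℝ, 1 < r → ∫⁻ x in Set.Ioc (0 : ℝ) 1, ENNReal.ofReal x ^ (-(1 / r)) ≠ ⊤ := by
    intro r hr
    have h1 : 1 / r < 1 := by rw [div_lt_one (by linarith)]; exact hr
    have := setLIntegral_Ioc_rpow (b := 1 - 1 / r) (M := 1) (by linarith) zero_le_one
    rw [show 1 - 1 / r - 1 = -(1 / r) by ring] at this
    rw [this]
    exact ENNReal.ofReal_ne_top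
  set K₁ := ∫⁻ x in Set.Ioc (0 : ℝ) 1, ENNReal.ofReal x ^ (-(1 / p₁))
  set K₂ := ∫⁻ x in Set.Ioc (0 : ℝ) 1, ENNReal.ofReal x ^ (-(1 / p₂))
  have hK₃ : ∫⁻ x in Set.Ioi (1 : ℝ), ENNReal.ofReal x ^ (-(1 / p₁ + 1 / p₂)) ≠ ⊤ := by
    have h0 : 0 < 1 / p := by positivity
    have hi := integrableOn_Ioi_rpow_of_lt (a := -(1 / p₁ + 1 / p₂)) (c := 1) (by linarith) one_pos
    convert! hi.lintegral_lt_top.ne using 1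
    exact setLIntegral_congr_fun measurableSet_Ioi fun x hx => ENNReal.ofReal_rpow_of_pos (hIoi hx)
  set K₃ := ∫⁻ x in Set.Ioi (1 : ℝ), ENNReal.ofReal x ^ (-(1 / p₁ + 1 / p₂))
  refine ⟨K₁ * K₂ + K₃, ENNReal.add_ne_top.mpr
    ⟨ENNReal.mul_ne_top (hKfin _ hp₁) (hKfin _ hp₂), hK₃⟩, fun R₁ R₂ hR₁ hR₂ => ?_⟩
  set φ : ℝ → ℝ≥0∞ := fun t => ENNReal.ofReal t ^ (1 / p₁) * R₁ t with hφ
  set ψ : ℝ → ℝ≥0∞ := fun t => ENNReal.ofReal t ^ (1 / p₂) * R₂ t with hψ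
  have mφ : Measurable φ := by fun_prop
  have mψ : Measurable ψ := by fun_prop
  set A : ℝ → ℝ≥0∞ := fun t => ∫⁻ x in Set.Ioc 0 1, ENNReal.ofReal x ^ (-(1 / p₁)) * φ (t * x)
  set B : ℝ → ℝ≥0∞ := fun t => ∫⁻ x in Set.Ioc 0 1, ENNReal.ofReal x ^ (-(1 / p₂)) * ψ (t * x)
  set D : ℝ → ℝ≥0∞ := fun t => ∫⁻ x in Set.Ioi 1, ENNReal.ofReal x ^ (-(1 / p₁ + 1 / p₂)) *
    (φ (t * x) * ψ (t * x))
  have mA : Measurable A := measurable_setLIntegral_dilation (by fun_prop) mφ _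
  have mB : Measurable B := measurable_setLIntegral_dilation (by fun_prop) mψ _
  have mD : Measurable D :=
    measurable_setLIntegral_dilation (φ := fun t => φ t * ψ t) (by fun_prop) (by fun_prop) _
  have hpt : ∀ t, 0 < t → ENNReal.ofReal t ^ (1 / p) * oneil R₁ R₂ t ≤ A t * B t + D t := by
    intro t ht
    have ht0 : ENNReal.ofReal t ≠ 0 := by simpa using ht
    have e : ENNReal.ofReal t ^ (1 / p) * ENNReal.ofReal t =
        ENNReal.ofReal t ^ (1 / p₁) * ENNReal.ofReal t ^ (1 / p₂) := by
      rw [← ENNReal.rpow_add _ _ ht0 (by simp), ← hpe, ENNReal.rpow_add _ _ ht0 (by simp),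
        ENNReal.rpow_one]
    have hA := rpow_mul_setLIntegral_dilation (a := 1 / p₁) ht measurableSet_Ioc hIoc R₁
    have hB := rpow_mul_setLIntegral_dilation (a := 1 / p₂) ht measurableSet_Ioc hIoc R₂
    have hD := rpow_mul_setLIntegral_dilation (a := 1 / p₁ + 1 / p₂) ht measurableSet_Ioi hIoi
      (fun x => R₁ x * R₂ x)
    have hD' : D t = ∫⁻ x in Set.Ioi 1, ENNReal.ofReal x ^ (-(1 / p₁ + 1 / p₂)) *
        (ENNReal.ofReal (t * x) ^ (1 / p₁ + 1 / p₂) * (R₁ (t * x) * R₂ (t * x))) := by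
      refine setLIntegral_congr_fun measurableSet_Ioi fun x hx => ?_
      have hx0 : 0 < t * x := mul_pos ht (hIoi hx)
      rw [ENNReal.rpow_add _ _ (by simpa using hx0) (by simp)]
      simp only [hφ, hψ]
      ring
    rw [hD', ← hD, show A t = _ from hA.symm, show B t = _ from hB.symm,
      ENNReal.rpow_add _ _ ht0 (by simp)]
    unfold oneil
    rw [mul_add, ← mul_assoc, ← mul_assoc (ENNReal.ofReal t ^ (1 / p)), e]
    refine le_of_eq ?_
    ring
  calc _ ≤ mulNorm q (fun t => A t * B t + D t) := mulNorm_mono hpt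
    _ ≤ mulNorm q (fun t => A t * B t) + mulNorm q D := mulNorm_add_le hq (by fun_prop) mD
    _ ≤ mulNorm q₁ A * mulNorm q₂ B + K₃ * mulNorm q (fun t => φ t * ψ t) := by
        gcongr
        · exact mulNorm_mul_le hq hq₁ hq₂ hqe mA mB
        · exact mulNorm_lintegral_dilation_le hq measurableSet_Ioi hIoi (by fun_prop)
            (φ := fun t => φ t * ψ t) (by fun_prop)
    _ ≤ (K₁ * mulNorm q₁ φ) * (K₂ * mulNorm q₂ ψ) + K₃ * (mulNorm q₁ φ * mulNorm q₂ ψ) := by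
        gcongr
        · exact mulNorm_lintegral_dilation_le hq₁ measurableSet_Ioc hIoc (by fun_prop) mφ
        · exact mulNorm_lintegral_dilation_le hq₂ measurableSet_Ioc hIoc (by fun_prop) mψ
        · exact mulNorm_mul_le hq hq₁ hq₂ hqe mφ mψ
    _ = _ := by ring

theorem ofReal_lt_enorm_iff {E : Type*} [NormedAddCommGroup E] {l : ℝ} (hl : 0 ≤ l) (z : E) :
    ENNReal.ofReal l < ‖z‖ₑ ↔ l < ‖z‖ := by
  rw [← ofReal_norm, ENNReal.ofReal_lt_ofReal_iff_of_nonneg hl]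

theorem mulNorm_rearr_le {q : ℝ≥0∞} (hq : 1 ≤ q) {p : ℝ} (hp : 0 < p) :
    ∃ C : ℝ≥0∞, C ≠ ⊤ ∧ ∀ {α : Type} [MeasurableSpace α] (μ : Measure α) (f : α → ℂ),
      mulNorm q (fun t => ENNReal.ofReal t ^ (1 / p) *
        rearr (fun s => μ {x | ENNReal.ofReal s < ‖f x‖ₑ}) t) ≤ C * lorentzNorm μ p q f := by
  obtain ⟨C, hC, h⟩ := mulNorm_le_of_rel hq (one_div_pos.mpr hp) one_pos
  refine ⟨C, hC, fun μ f => ?_⟩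
  have hd := antitone_distribution μ fun x => ‖f x‖ₑ
  have := h _ _ (measurable_rearr hd.measurable) fun s t _ _ hst => (lt_of_lt_rearr hd hst).le
  simp only [ENNReal.rpow_one] at this
  refine this.trans ?_
  rw [lorentzNorm_eq_mulNorm]
  gcongr
  refine mulNorm_mono fun t ht => le_of_eq ?_
  simp only [ofReal_lt_enorm_iff ht.le]

theorem ofReal_le_oneil_of_lt {d : ℕ} {f g : EuclideanSpace ℝ (Fin d) → ℂ} (hf : Measurable f)
    (hg : Measurable g) {s t : ℝ} (hs : 0 < s) (ht : 0 < t)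
    (h : ENNReal.ofReal s < volume {x | t < ‖∫ y, f (x - y) * g y‖}) :
    ENNReal.ofReal t ≤ oneil (rearr fun s => volume {x | ENNReal.ofReal s < ‖f x‖ₑ})
      (rearr fun s => volume {x | ENNReal.ofReal s < ‖g x‖ₑ}) s := by
  have h' : ENNReal.ofReal s <
      volume {x | ENNReal.ofReal t < ∫⁻ y, ‖f (x - y)‖ₑ * ‖g y‖ₑ} := by
    refine h.trans_le (measure_mono fun x hx => ?_)
    refine ((ofReal_lt_enorm_iff ht.le _).mpr hx).trans_le ?_
    simpa only [enorm_mul] using enorm_integral_le_lintegral_enorm fun y => f (x - y) * g y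
  have key := mul_le_of_lt_measure_conv hf.enorm hg.enorm hs h'
  have hpre : (fun x => s * x) ⁻¹' Set.Ioc 0 s = Set.Ioc 0 1 := by
    ext x
    simp [hs, div_self hs.ne']
  have hpre' : (fun x => s * x) ⁻¹' Set.Ioi s = Set.Ioi 1 := by
    ext x
    simp [hs, div_self hs.ne']
  rw [setLIntegral_eq_ofReal_mul_comp hs measurableSet_Ioc,
    setLIntegral_eq_ofReal_mul_comp hs measurableSet_Ioc,
    setLIntegral_eq_ofReal_mul_comp hs measurableSet_Ioi, hpre, hpre'] at key
  rw [← ENNReal.mul_le_mul_iff_left (c := ENNReal.ofReal s) (by simpa using hs) (by simp)]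
  refine key.trans_eq ?_
  unfold oneil
  ring

end LorentzYoung

/-- Young's convolution inequality in Lorentz spaces on `ℝ^d`:
if `1/p + 1 = 1/p₁ + 1/p₂` and `1/q = 1/q₁ + 1/q₂` with `1 < p, p₁, p₂ < ∞`, then
`‖f ∗ g‖_{L^{p,q}} ≤ C ‖f‖_{L^{p₁,q₁}} ‖g‖_{L^{p₂,q₂}}`. -/
theorem lorentz_young (d : ℕ) (hd : 1 ≤ d)
    (p p₁ p₂ : ℝ) (hp : 1 < p) (hp₁ : 1 < p₁) (hp₂ : 1 < p₂)
    (q q₁ q₂ : ℝ≥0∞) (hq : 1 ≤ q) (hq₁ : 1 ≤ q₁) (hq₂ : 1 ≤ q₂)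
    (hpe : 1 / p + 1 = 1 / p₁ + 1 / p₂) (hqe : q⁻¹ = q₁⁻¹ + q₂⁻¹) :
    ∃ C : ℝ, 0 < C ∧ ∀ f g : EuclideanSpace ℝ (Fin d) → ℂ, Measurable f → Measurable g →
      lorentzNorm volume p q (fun x => ∫ y, f (x - y) * g y) ≤
        ENNReal.ofReal C * (lorentzNorm volume p₁ q₁ f * lorentzNorm volume p₂ q₂ g) := by
  open LorentzYoung in
  obtain ⟨C₀, hC₀, h₀⟩ := mulNorm_le_of_rel hq one_pos (one_div_pos.mpr (one_pos.trans hp))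
  obtain ⟨C₁, hC₁, h₁⟩ := mulNorm_rearr_le hq₁ (one_pos.trans hp₁)
  obtain ⟨C₂, hC₂, h₂⟩ := mulNorm_rearr_le hq₂ (one_pos.trans hp₂)
  obtain ⟨C₃, hC₃, h₃⟩ := mulNorm_oneil_le hp hp₁ hp₂ hq hq₁ hq₂ hpe hqe
  have hC : C₀ * (C₃ * (C₁ * C₂)) ≠ ⊤ := by finiteness
  refine ⟨(C₀ * (C₃ * (C₁ * C₂))).toReal + 1, by positivity, fun f g hf hg => ?_⟩
  set R₁ := rearr fun s => volume {x | ENNReal.ofReal s < ‖f x‖ₑ}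
  set R₂ := rearr fun s => volume {x | ENNReal.ofReal s < ‖g x‖ₑ}
  have hD : Measurable fun l : ℝ => volume {x | l < ‖∫ y, f (x - y) * g y‖} :=
    Antitone.measurable fun a b hab => measure_mono fun x hx => hab.trans_lt hx
  calc lorentzNorm volume p q (fun x => ∫ y, f (x - y) * g y)
      ≤ C₀ * mulNorm q (fun s => ENNReal.ofReal s ^ (1 / p) * oneil R₁ R₂ s) := by
        rw [lorentzNorm_eq_mulNorm]
        simpa only [ENNReal.rpow_one] using h₀ _ (oneil R₁ R₂) hD
          fun s t hs ht hst => ofReal_le_oneil_of_lt hf hg hs ht hst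
    _ ≤ C₀ * (C₃ * ((C₁ * lorentzNorm volume p₁ q₁ f) * (C₂ * lorentzNorm volume p₂ q₂ g))) := by
        gcongr
        refine (h₃ R₁ R₂ (measurable_rearr (antitone_distribution _ _).measurable)
          (measurable_rearr (antitone_distribution _ _).measurable)).trans ?_
        gcongr
        · exact h₁ volume f
        · exact h₂ volume g
    _ = C₀ * (C₃ * (C₁ * C₂)) * (lorentzNorm volume p₁ q₁ f * lorentzNorm volume p₂ q₂ g) := by
        ring
    _ ≤ _ := by
        gcongr
        rw [ENNReal.le_ofReal_iff_toReal_le hC (by positivity)]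
        linarith
end

section
/- (Lorentz-space Sobolev embedding) Let d ≥ 1, 0 < s < d, 1 < p < r < ∞ with d/r = d/p − s, and 1 ≤ q ≤ ∞. Then there exists C such that for all Schwartz f on ℝ^d, ‖|∇|^{-s} f‖_{L^{r,q}} ≤ C ‖f‖_{L^{p,q}}. -/
open MeasureTheory ENNReal

open Set

lemma rpow_le_rpow_of_exponent_nonpos {x y : ℝ≥0∞} {z : ℝ} (hz : z ≤ 0) (h : x ≤ y) :
    y ^ z ≤ x ^ z := by
  rw [← neg_neg z, ENNReal.rpow_neg, ENNReal.rpow_neg x, ENNReal.inv_le_inv]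
  exact ENNReal.rpow_le_rpow h (by linarith)

lemma lintegral_rpow_Ioc {b x : ℝ} (hb : 0 < b) (hx : 0 ≤ x) :
    ∫⁻ t in Ioc (0 : ℝ) x, ENNReal.ofReal t ^ (b - 1) =
      ENNReal.ofReal x ^ b / ENNReal.ofReal b := by
  have h1 : IntegrableOn (fun t : ℝ => t ^ (b - 1)) (Ioc 0 x) :=
    (intervalIntegrable_iff_integrableOn_Ioc_of_le hx).1
      (intervalIntegral.intervalIntegrable_rpow' (by linarith))
  have h2 : ∫⁻ t in Ioc (0 : ℝ) x, ENNReal.ofReal t ^ (b - 1) =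
      ∫⁻ t in Ioc (0 : ℝ) x, ENNReal.ofReal (t ^ (b - 1)) :=
    setLIntegral_congr_fun measurableSet_Ioc fun t ht => ENNReal.ofReal_rpow_of_pos ht.1
  rw [h2, ← ofReal_integral_eq_lintegral_ofReal h1
    ((ae_restrict_iff' measurableSet_Ioc).2 (.of_forall fun t ht => Real.rpow_nonneg ht.1.le _)),
    ← intervalIntegral.integral_of_le hx, integral_rpow (.inl (by linarith)), sub_add_cancel,
    Real.zero_rpow hb.ne', sub_zero, ENNReal.ofReal_div_of_pos hb,
    ENNReal.ofReal_rpow_of_nonneg hx hb.le]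

lemma setLIntegral_rpow_le {b : ℝ} (hb : 0 < b) {S : Set ℝ} {n : ℝ≥0∞}
    (hS : ∀ t ∈ S, 0 < t ∧ ENNReal.ofReal t ≤ n) :
    ∫⁻ t in S, ENNReal.ofReal t ^ (b - 1) ≤ n ^ b / ENNReal.ofReal b := by
  rcases eq_or_ne n ⊤ with rfl | hn
  · simp [ENNReal.top_rpow_of_pos hb, ENNReal.top_div]
  · refine (lintegral_mono_set (t := Ioc 0 n.toReal) fun t ht =>
      ⟨(hS t ht).1, (ENNReal.ofReal_le_iff_le_toReal hn).1 (hS t ht).2⟩).trans_eq ?_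
    rw [lintegral_rpow_Ioc hb toReal_nonneg, ENNReal.ofReal_toReal hn]

lemma le_setLIntegral_rpow {b : ℝ} (hb : 0 < b) {S : Set ℝ} {n : ℝ≥0∞}
    (hS : ∀ t, 0 < t → ENNReal.ofReal t < n → t ∈ S) :
    n ^ b / ENNReal.ofReal b ≤ ∫⁻ t in S, ENNReal.ofReal t ^ (b - 1) := by
  have key : ∀ m : ℝ≥0∞, m < n →
      m ^ b / ENNReal.ofReal b ≤ ∫⁻ t in S, ENNReal.ofReal t ^ (b - 1) := fun m hm => by
    have hm' := hm.ne_top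
    conv_lhs => rw [← ENNReal.ofReal_toReal hm']
    rw [← lintegral_rpow_Ioc hb toReal_nonneg]
    exact lintegral_mono_set fun t ht =>
      hS t ht.1 (((ENNReal.ofReal_le_iff_le_toReal hm').2 ht.2).trans_lt hm)
  rcases eq_or_ne n 0 with rfl | hn
  · simp [ENNReal.zero_rpow_of_pos hb]
  · have hcont : Continuous fun m : ℝ≥0∞ => m ^ b / ENNReal.ofReal b :=
      (ENNReal.continuous_div_const _ (by simpa using hb)).comp ENNReal.continuous_rpow_const
    have := (nhdsWithin_Iio_neBot' ⟨0, pos_iff_ne_zero.2 hn⟩ le_rfl : (nhdsWithin n (Iio n)).NeBot)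
    exact le_of_tendsto (hcont.continuousWithinAt (s := Iio n) (x := n))
      (eventually_mem_nhdsWithin.mono key)

lemma setLIntegral_Ioi_zero_comp_mul_left (F : ℝ → ℝ≥0∞) (hF : Measurable F) {a : ℝ}
    (ha : 0 < a) :
    ∫⁻ u in Ioi (0 : ℝ), F u = ENNReal.ofReal a * ∫⁻ v in Ioi (0 : ℝ), F (a * v) := by
  conv_lhs => rw [← Real.smul_map_volume_mul_left ha.ne']
  rw [Measure.restrict_smul, lintegral_smul_measure,
    setLIntegral_map measurableSet_Ioi hF (measurable_const_mul a), abs_of_pos ha, smul_eq_mul]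
  congr 3
  ext v
  simp [ha]

lemma lintegral_mul_setLIntegral_swap {N F G : ℝ → ℝ≥0∞} (hN : Measurable N)
    (hF : Measurable F) (hG : Measurable G) :
    ∫⁻ l in Ioi (0 : ℝ), G l * ∫⁻ t in Ioi (0 : ℝ) ∩ {t | ENNReal.ofReal t < N l}, F t =
      ∫⁻ t in Ioi (0 : ℝ), F t * ∫⁻ l in Ioi (0 : ℝ) ∩ {l | ENNReal.ofReal t < N l}, G l := by
  have hm : MeasurableSet {z : ℝ × ℝ | ENNReal.ofReal z.2 < N z.1} :=
    measurableSet_lt (by fun_prop) (by fun_prop)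
  have h1 : ∀ l, G l * ∫⁻ t in Ioi (0 : ℝ) ∩ {t | ENNReal.ofReal t < N l}, F t =
      ∫⁻ t in Ioi (0 : ℝ), {z : ℝ × ℝ | ENNReal.ofReal z.2 < N z.1}.indicator
        (fun z => G z.1 * F z.2) (l, t) := fun l => by
    have hl : MeasurableSet {t | ENNReal.ofReal t < N l} :=
      measurableSet_lt (by fun_prop) (by fun_prop)
    rw [inter_comm, ← setLIntegral_indicator hl, ← lintegral_const_mul _ (hF.indicator hl)]
    refine lintegral_congr fun t => ?_
    by_cases h : ENNReal.ofReal t < N l <;> simp [h, indicator]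
  have h2 : ∀ t, F t * ∫⁻ l in Ioi (0 : ℝ) ∩ {l | ENNReal.ofReal t < N l}, G l =
      ∫⁻ l in Ioi (0 : ℝ), {z : ℝ × ℝ | ENNReal.ofReal z.2 < N z.1}.indicator
        (fun z => G z.1 * F z.2) (l, t) := fun t => by
    have hl : MeasurableSet {l | ENNReal.ofReal t < N l} :=
      measurableSet_lt (by fun_prop) (by fun_prop)
    rw [inter_comm, ← setLIntegral_indicator hl, ← lintegral_const_mul _ (hG.indicator hl)]
    refine lintegral_congr fun l => ?_
    by_cases h : ENNReal.ofReal t < N l <;> simp [h, indicator, mul_comm]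
  simp_rw [h1, h2]
  refine lintegral_lintegral_swap ?_
  exact (Measurable.indicator (by fun_prop) hm).aemeasurable

/-- The measure of the superlevel set at height `u`: the decreasing rearrangement of a function
with distribution function `N`. -/
noncomputable def decrRearr (N : ℝ → ℝ≥0∞) (u : ℝ) : ℝ≥0∞ :=
  volume (Ioi (0 : ℝ) ∩ {l | ENNReal.ofReal u < N l})

lemma antitone_decrRearr (N : ℝ → ℝ≥0∞) : Antitone (decrRearr N) := fun _ _ h =>
  measure_mono (inter_subset_inter_right _ fun _ hl =>
    (ENNReal.ofReal_le_ofReal h).trans_lt hl)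

lemma lt_of_lt_decrRearr {N : ℝ → ℝ≥0∞} (hN : Antitone N) {u l : ℝ}
    (h : ENNReal.ofReal l < decrRearr N u) : ENNReal.ofReal u < N l := by
  by_contra! hl
  refine h.not_ge ((measure_mono (t := Ioo 0 l) fun k hk => ⟨hk.1, ?_⟩).trans_eq (by simp))
  by_contra! hk'
  exact (hk.2.trans_le (hN hk')).not_ge hl

/-- The integral of `min (N ^ σ) (N t ^ (σ - 1))` bounding averages of a Riesz potential. -/
noncomputable def potentialBound (σ : ℝ) (N : ℝ → ℝ≥0∞) (t : ℝ) : ℝ≥0∞ :=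
  ∫⁻ l in Ioi (0 : ℝ), min (N l ^ σ) (N l * ENNReal.ofReal t ^ (σ - 1))

lemma min_le_setLIntegral_max_rpow {σ : ℝ} (hσ : σ < 1) {n : ℝ≥0∞} (hn : n ≠ ⊤) {t : ℝ}
    (ht : 0 < t) :
    min (n ^ σ) (n * ENNReal.ofReal t ^ (σ - 1)) ≤
      ∫⁻ u in Ioi (0 : ℝ) ∩ {u | ENNReal.ofReal u < n},
        ENNReal.ofReal (max u t) ^ (σ - 1) := by
  have hms : MeasurableSet (Ioi (0 : ℝ) ∩ {u | ENNReal.ofReal u < n}) :=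
    measurableSet_Ioi.inter (measurableSet_lt (by fun_prop) (by fun_prop))
  have hvol : n ≤ volume (Ioi (0 : ℝ) ∩ {u | ENNReal.ofReal u < n}) := by
    refine le_trans (le_of_eq ?_) (measure_mono (s := Ioo 0 n.toReal) fun u hu =>
      ⟨hu.1, (ENNReal.ofReal_lt_iff_lt_toReal hu.1.le hn).2 hu.2⟩)
    simp [hn]
  have ht0 : ENNReal.ofReal t ≠ 0 := by simpa using ht
  calc min (n ^ σ) (n * ENNReal.ofReal t ^ (σ - 1))
      ≤ max n (ENNReal.ofReal t) ^ (σ - 1) * n := by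
        rcases le_total n (ENNReal.ofReal t) with h | h
        · rw [max_eq_right h, mul_comm]
          exact min_le_right _ _
        · rw [max_eq_left h]
          refine (min_le_left _ _).trans_eq ?_
          have hn0 : n ≠ 0 := fun h0 => ht0 (le_antisymm (h0 ▸ h) bot_le)
          conv_rhs => rw [← ENNReal.rpow_one n, ← ENNReal.rpow_mul, one_mul,
            ← ENNReal.rpow_add _ _ hn0 hn, sub_add_cancel]
    _ ≤ max n (ENNReal.ofReal t) ^ (σ - 1) *
          volume (Ioi (0 : ℝ) ∩ {u | ENNReal.ofReal u < n}) := by gcongr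
    _ = ∫⁻ u in Ioi (0 : ℝ) ∩ {u | ENNReal.ofReal u < n},
          max n (ENNReal.ofReal t) ^ (σ - 1) := by rw [setLIntegral_const]
    _ ≤ _ := by
        refine setLIntegral_mono_ae (by fun_prop) (.of_forall fun u hu => ?_)
        refine rpow_le_rpow_of_exponent_nonpos (by linarith) ?_
        rw [ENNReal.ofReal_max]
        exact max_le_max_right _ hu.2.le

/-- The dilation-invariant Hardy-type kernel on the half-line. -/
noncomputable def hardyKernel (σ v : ℝ) : ℝ≥0∞ := ENNReal.ofReal (max v 1) ^ (σ - 1)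

lemma measurable_hardyKernel (σ : ℝ) : Measurable (hardyKernel σ) := by
  unfold hardyKernel
  fun_prop

lemma potentialBound_le {σ : ℝ} (hσ : σ < 1) {N : ℝ → ℝ≥0∞} (hN : Antitone N)
    (hfin : ∀ l, 0 < l → N l ≠ ⊤) {t : ℝ} (ht : 0 < t) :
    potentialBound σ N t ≤ ENNReal.ofReal t ^ σ *
      ∫⁻ v in Ioi (0 : ℝ), hardyKernel σ v * decrRearr N (t * v) := by
  have hd := (antitone_decrRearr N).measurable
  have ht0 : ENNReal.ofReal t ≠ 0 := by simpa using ht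
  calc potentialBound σ N t
      ≤ ∫⁻ l in Ioi (0 : ℝ), (1 : ℝ≥0∞) * ∫⁻ u in Ioi (0 : ℝ) ∩ {u | ENNReal.ofReal u < N l},
        ENNReal.ofReal (max u t) ^ (σ - 1) := by
        refine setLIntegral_mono' measurableSet_Ioi fun l hl => ?_
        rw [one_mul]
        exact min_le_setLIntegral_max_rpow hσ (hfin l hl) ht
    _ = ∫⁻ u in Ioi (0 : ℝ), ENNReal.ofReal (max u t) ^ (σ - 1) * decrRearr N u := by
        rw [lintegral_mul_setLIntegral_swap hN.measurable (by fun_prop) (by fun_prop)]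
        simp [decrRearr]
    _ = ENNReal.ofReal t * ∫⁻ v in Ioi (0 : ℝ),
          ENNReal.ofReal (max (t * v) t) ^ (σ - 1) * decrRearr N (t * v) :=
        setLIntegral_Ioi_zero_comp_mul_left _ (by fun_prop) ht
    _ = ENNReal.ofReal t * ∫⁻ v in Ioi (0 : ℝ),
          ENNReal.ofReal t ^ (σ - 1) * (hardyKernel σ v * decrRearr N (t * v)) := by
        congr 1
        refine lintegral_congr fun v => ?_
        have : max (t * v) t = t * max v 1 := by rw [mul_max_of_nonneg _ _ ht.le, mul_one]
        rw [this, ENNReal.ofReal_mul ht.le, ENNReal.mul_rpow_of_ne_top (by simp) (by simp),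
          hardyKernel, mul_assoc]
    _ = _ := by
        rw [lintegral_const_mul _ (by have := measurable_hardyKernel σ; fun_prop), ← mul_assoc]
        congr 1
        conv_lhs => rw [← ENNReal.rpow_one (ENNReal.ofReal t), ← ENNReal.rpow_mul, one_mul,
            ← ENNReal.rpow_add _ _ ht0 (by simp), add_sub_cancel]

/-- The norm of `hardyKernel` on the functions homogeneous of degree `-a`. -/
noncomputable def hardyConst (σ a : ℝ) : ℝ≥0∞ :=
  ∫⁻ v in Ioi (0 : ℝ), hardyKernel σ v * ENNReal.ofReal v ^ (-a)

lemma hardyConst_ne_top {σ a : ℝ} (ha : a < 1) (hσ : σ < a) : hardyConst σ a ≠ ⊤ := by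
  have h1 : ∫⁻ v in Ioc (0 : ℝ) 1, hardyKernel σ v * ENNReal.ofReal v ^ (-a) ≠ ⊤ := by
    have : ∫⁻ v in Ioc (0 : ℝ) 1, hardyKernel σ v * ENNReal.ofReal v ^ (-a) =
        ∫⁻ v in Ioc (0 : ℝ) 1, ENNReal.ofReal v ^ ((1 - a) - 1) :=
      setLIntegral_congr_fun measurableSet_Ioc fun v hv => by
        simp [hardyKernel, max_eq_right hv.2]
    rw [this, lintegral_rpow_Ioc (by linarith) zero_le_one]
    simpa [ENNReal.div_eq_top] using ha
  have h2 : ∫⁻ v in Ioi (1 : ℝ), hardyKernel σ v * ENNReal.ofReal v ^ (-a) ≠ ⊤ := by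
    have : ∫⁻ v in Ioi (1 : ℝ), hardyKernel σ v * ENNReal.ofReal v ^ (-a) =
        ∫⁻ v in Ioi (1 : ℝ), ENNReal.ofReal (v ^ (σ - 1 - a)) :=
      setLIntegral_congr_fun measurableSet_Ioi fun v (hv : 1 < v) => by
        have hv0 : 0 < v := by linarith
        simp only [hardyKernel, max_eq_left hv.le]
        rw [← ENNReal.rpow_add _ _ (by simpa using hv0) (by simp),
          ENNReal.ofReal_rpow_of_pos hv0, ← sub_eq_add_neg]
    rw [this]
    exact (integrableOn_Ioi_rpow_of_lt (by linarith) one_pos).lintegral_lt_top.ne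
  rw [hardyConst, ← Ioc_union_Ioi_eq_Ioi (zero_le_one' ℝ),
    lintegral_union measurableSet_Ioi (Ioc_disjoint_Ioi le_rfl)]
  exact ENNReal.add_ne_top.2 ⟨h1, h2⟩

lemma lintegral_rpow_le_measure_univ_mul {α : Type*} [MeasurableSpace α] (ν : Measure α)
    {h : α → ℝ≥0∞} (hh : Measurable h) {Q : ℝ} (hQ : 1 ≤ Q) :
    (∫⁻ x, h x ∂ν) ^ Q ≤ ν univ ^ (Q - 1) * ∫⁻ x, h x ^ Q ∂ν := by
  have hQ0 : 0 < Q := by linarith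
  have := eLpNorm'_le_eLpNorm'_mul_rpow_measure_univ (μ := ν) one_pos hQ
    hh.aestronglyMeasurable
  simp only [eLpNorm', enorm_eq_self, ENNReal.rpow_one, div_one] at this
  calc _ ≤ ((∫⁻ x, h x ^ Q ∂ν) ^ (1 / Q) * ν univ ^ (1 - 1 / Q)) ^ Q := by gcongr
    _ = _ := by
      rw [ENNReal.mul_rpow_of_nonneg _ _ hQ0.le, ← ENNReal.rpow_mul, ← ENNReal.rpow_mul,
        one_div_mul_cancel hQ0.ne', ENNReal.rpow_one, mul_comm, sub_mul,
        one_div_mul_cancel hQ0.ne', one_mul]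

lemma lintegral_rpow_mul_comp_mul {F : ℝ → ℝ≥0∞} (hF : Measurable F) {b v : ℝ} (hv : 0 < v) :
    ∫⁻ t in Ioi (0 : ℝ), ENNReal.ofReal t ^ (b - 1) * (ENNReal.ofReal v ^ b * F (t * v)) =
      ∫⁻ t in Ioi (0 : ℝ), ENNReal.ofReal t ^ (b - 1) * F t := by
  rw [setLIntegral_Ioi_zero_comp_mul_left (fun t => ENNReal.ofReal t ^ (b - 1) * F t)
    (by fun_prop) hv, ← lintegral_const_mul _ (by fun_prop)]
  refine lintegral_congr fun t => ?_
  have hv0 : ENNReal.ofReal v ≠ 0 := by simpa using hv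
  have : ENNReal.ofReal v ^ b = ENNReal.ofReal v * ENNReal.ofReal v ^ (b - 1) := by
    conv_rhs => rw [← ENNReal.rpow_one (ENNReal.ofReal v), ← ENNReal.rpow_mul, one_mul,
      ← ENNReal.rpow_add _ _ hv0 (by simp), add_sub_cancel]
  rw [this, ENNReal.ofReal_mul hv.le, ENNReal.mul_rpow_of_ne_top (by simp) (by simp), mul_comm t]
  ring

lemma lintegral_potentialBound_rpow_le {σ a Q : ℝ} (hσ : σ < 1) (hQ : 1 ≤ Q)
    {N : ℝ → ℝ≥0∞} (hN : Antitone N) (hfin : ∀ l, 0 < l → N l ≠ ⊤) :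
    ∫⁻ t in Ioi (0 : ℝ), ENNReal.ofReal t ^ (Q * (a - σ) - 1) * potentialBound σ N t ^ Q ≤
      hardyConst σ a ^ Q *
        ∫⁻ t in Ioi (0 : ℝ), ENNReal.ofReal t ^ (Q * a - 1) * decrRearr N t ^ Q := by
  have hQ0 : 0 < Q := by linarith
  have hd := (antitone_decrRearr N).measurable
  have hk := measurable_hardyKernel σ
  set w : ℝ → ℝ≥0∞ := fun v => hardyKernel σ v * ENNReal.ofReal v ^ (-a) with hw
  have hwm : Measurable w := by fun_prop
  set ν := (volume.restrict (Ioi (0 : ℝ))).withDensity w with hν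
  have hνu : ν univ = hardyConst σ a := by
    rw [hν, withDensity_apply _ MeasurableSet.univ, Measure.restrict_univ, hardyConst]
  have hνpos : ∀ᵐ v ∂ν, 0 < v :=
    (withDensity_absolutelyContinuous _ _).ae_le (ae_restrict_mem measurableSet_Ioi)
  have hpt : ∀ t : ℝ, 0 < t →
      ENNReal.ofReal t ^ (Q * (a - σ) - 1) * potentialBound σ N t ^ Q ≤
      hardyConst σ a ^ (Q - 1) * ∫⁻ v, ENNReal.ofReal t ^ (Q * a - 1) *
        (ENNReal.ofReal v ^ (Q * a) * decrRearr N (t * v) ^ Q) ∂ν := fun t ht => by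
    have ht0 : ENNReal.ofReal t ≠ 0 := by simpa using ht
    have hint : ∫⁻ v in Ioi (0 : ℝ), hardyKernel σ v * decrRearr N (t * v) =
        ∫⁻ v, ENNReal.ofReal v ^ a * decrRearr N (t * v) ∂ν := by
      rw [hν, lintegral_withDensity_eq_lintegral_mul _ hwm (by fun_prop)]
      refine setLIntegral_congr_fun measurableSet_Ioi fun v (hv : 0 < v) => ?_
      have hv0 : ENNReal.ofReal v ≠ 0 := by simpa using hv
      have : ENNReal.ofReal v ^ (-a) * ENNReal.ofReal v ^ a = 1 := by
        rw [← ENNReal.rpow_add _ _ hv0 (by simp), neg_add_cancel, ENNReal.rpow_zero]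
      simp only [hw, Pi.mul_apply]
      calc _ = hardyKernel σ v * (ENNReal.ofReal v ^ (-a) * ENNReal.ofReal v ^ a) *
            decrRearr N (t * v) := by rw [this, mul_one]
        _ = _ := by ring
    calc ENNReal.ofReal t ^ (Q * (a - σ) - 1) * potentialBound σ N t ^ Q
        ≤ ENNReal.ofReal t ^ (Q * (a - σ) - 1) * (ENNReal.ofReal t ^ σ *
          ∫⁻ v, ENNReal.ofReal v ^ a * decrRearr N (t * v) ∂ν) ^ Q := by
          gcongr
          exact hint ▸ potentialBound_le hσ hN hfin ht
      _ = ENNReal.ofReal t ^ (Q * a - 1) *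
          (∫⁻ v, ENNReal.ofReal v ^ a * decrRearr N (t * v) ∂ν) ^ Q := by
          rw [ENNReal.mul_rpow_of_nonneg _ _ hQ0.le, ← ENNReal.rpow_mul, ← mul_assoc,
            ← ENNReal.rpow_add _ _ ht0 (by simp)]
          congr 2
          ring
      _ ≤ ENNReal.ofReal t ^ (Q * a - 1) * (hardyConst σ a ^ (Q - 1) *
          ∫⁻ v, (ENNReal.ofReal v ^ a * decrRearr N (t * v)) ^ Q ∂ν) := by
          gcongr
          exact hνu ▸ lintegral_rpow_le_measure_univ_mul ν (by fun_prop) hQ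
      _ = _ := by
          rw [lintegral_const_mul _ (by fun_prop), mul_left_comm]
          simp_rw [ENNReal.mul_rpow_of_nonneg _ _ hQ0.le, ← ENNReal.rpow_mul, mul_comm a Q]
  calc _ ≤ ∫⁻ t in Ioi (0 : ℝ), hardyConst σ a ^ (Q - 1) *
        ∫⁻ v, ENNReal.ofReal t ^ (Q * a - 1) *
        (ENNReal.ofReal v ^ (Q * a) * decrRearr N (t * v) ^ Q) ∂ν :=
        setLIntegral_mono' measurableSet_Ioi hpt
    _ = hardyConst σ a ^ (Q - 1) * ∫⁻ v, (∫⁻ t in Ioi (0 : ℝ), ENNReal.ofReal t ^ (Q * a - 1) *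
        (ENNReal.ofReal v ^ (Q * a) * decrRearr N (t * v) ^ Q)) ∂ν := by
        rw [lintegral_const_mul _ (Measurable.lintegral_prod_right' (ν := ν)
          (f := fun z : ℝ × ℝ => ENNReal.ofReal z.1 ^ (Q * a - 1) *
          (ENNReal.ofReal z.2 ^ (Q * a) * decrRearr N (z.1 * z.2) ^ Q)) (by fun_prop)),
          lintegral_lintegral_swap]
        exact Measurable.aemeasurable (by fun_prop)
    _ = hardyConst σ a ^ (Q - 1) * ∫⁻ _, (∫⁻ t in Ioi (0 : ℝ), ENNReal.ofReal t ^ (Q * a - 1) *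
        decrRearr N t ^ Q) ∂ν := by
        congr 1
        refine lintegral_congr_ae (hνpos.mono fun v hv => ?_)
        exact lintegral_rpow_mul_comp_mul (F := fun t => decrRearr N t ^ Q) (by fun_prop) hv
    _ = _ := by
        rw [lintegral_const, hνu, mul_comm (∫⁻ _ in _, _), ← mul_assoc]
        congr 1
        rcases eq_or_ne (hardyConst σ a) 0 with h0 | h0
        · simp [h0, ENNReal.zero_rpow_of_pos hQ0]
        rcases eq_or_ne (hardyConst σ a) ⊤ with h1 | h1
        · rcases hQ.eq_or_lt with rfl | hQ1
          · simp
          · simp [h1, ENNReal.top_rpow_of_pos hQ0, ENNReal.top_rpow_of_pos (sub_pos.2 hQ1)]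
        · conv_lhs => rw [← ENNReal.rpow_one (hardyConst σ a), ← ENNReal.rpow_mul, one_mul,
            ← ENNReal.rpow_add _ _ h0 h1, sub_add_cancel]

lemma lintegral_decrRearr_rpow_le {b Q : ℝ} (hb : 0 < b) (hQ : 0 < Q)
    {N : ℝ → ℝ≥0∞} (hN : Antitone N) :
    (∫⁻ t in Ioi (0 : ℝ), ENNReal.ofReal t ^ (b - 1) * decrRearr N t ^ Q) /
        ENNReal.ofReal Q ≤
      (∫⁻ l in Ioi (0 : ℝ), ENNReal.ofReal l ^ (Q - 1) * N l ^ b) / ENNReal.ofReal b := by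
  have hb' : (ENNReal.ofReal b)⁻¹ ≠ ⊤ := by simpa using hb
  have hQ' : (ENNReal.ofReal Q)⁻¹ ≠ ⊤ := by simpa using hQ
  simp only [div_eq_mul_inv]
  rw [← lintegral_mul_const' _ _ hb', ← lintegral_mul_const' _ _ hQ']
  simp only [mul_assoc]
  simp only [← div_eq_mul_inv]
  calc _ ≤ ∫⁻ t in Ioi (0 : ℝ), ENNReal.ofReal t ^ (b - 1) *
        ∫⁻ l in Ioi (0 : ℝ) ∩ {l | ENNReal.ofReal t < N l}, ENNReal.ofReal l ^ (Q - 1) := by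
        gcongr with t
        exact le_setLIntegral_rpow hQ fun l hl h => ⟨hl, lt_of_lt_decrRearr hN h⟩
    _ = ∫⁻ l in Ioi (0 : ℝ), ENNReal.ofReal l ^ (Q - 1) *
        ∫⁻ t in Ioi (0 : ℝ) ∩ {t | ENNReal.ofReal t < N l}, ENNReal.ofReal t ^ (b - 1) :=
        (lintegral_mul_setLIntegral_swap hN.measurable (by fun_prop) (by fun_prop)).symm
    _ ≤ _ := by
        gcongr with l
        exact setLIntegral_rpow_le hb fun t ht => ⟨ht.1, ht.2.le⟩

lemma lintegral_rpow_distribution_le {b Q : ℝ} (hb : 0 < b) (hQ : 0 < Q)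
    {M Φ : ℝ → ℝ≥0∞} (hM : Antitone M)
    (h : ∀ l t : ℝ, 0 < l → 0 < t → ENNReal.ofReal t < M l → ENNReal.ofReal l ≤ Φ t) :
    (∫⁻ l in Ioi (0 : ℝ), ENNReal.ofReal l ^ (Q - 1) * M l ^ b) / ENNReal.ofReal b ≤
      (∫⁻ t in Ioi (0 : ℝ), ENNReal.ofReal t ^ (b - 1) * Φ t ^ Q) / ENNReal.ofReal Q := by
  have hb' : (ENNReal.ofReal b)⁻¹ ≠ ⊤ := by simpa using hb
  have hQ' : (ENNReal.ofReal Q)⁻¹ ≠ ⊤ := by simpa using hQ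
  simp only [div_eq_mul_inv]
  rw [← lintegral_mul_const' _ _ hb', ← lintegral_mul_const' _ _ hQ']
  simp only [mul_assoc]
  simp only [← div_eq_mul_inv]
  calc _ ≤ ∫⁻ l in Ioi (0 : ℝ), ENNReal.ofReal l ^ (Q - 1) *
        ∫⁻ t in Ioi (0 : ℝ) ∩ {t | ENNReal.ofReal t < M l}, ENNReal.ofReal t ^ (b - 1) := by
        gcongr with l
        exact le_setLIntegral_rpow hb fun t ht h => ⟨ht, h⟩
    _ = ∫⁻ t in Ioi (0 : ℝ), ENNReal.ofReal t ^ (b - 1) *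
        ∫⁻ l in Ioi (0 : ℝ) ∩ {l | ENNReal.ofReal t < M l}, ENNReal.ofReal l ^ (Q - 1) :=
        lintegral_mul_setLIntegral_swap hM.measurable (by fun_prop) (by fun_prop)
    _ ≤ _ := by
        refine setLIntegral_mono' measurableSet_Ioi fun t ht => ?_
        gcongr
        exact setLIntegral_rpow_le hQ fun l hl => ⟨hl.1, h l t hl.1 ht hl.2⟩

/-- Real interpolation for distribution functions, with the summability exponent `Q < ∞`. -/
lemma lintegral_rpow_le_of_potentialBound {σ a Q : ℝ} (hσ0 : 0 ≤ σ) (hσ : σ < 1) (hσa : σ < a)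
    (hQ : 1 ≤ Q) {M N : ℝ → ℝ≥0∞} (hM : Antitone M) (hN : Antitone N)
    (hfin : ∀ l, 0 < l → N l ≠ ⊤) {C : ℝ≥0∞} (hC : C ≠ ⊤)
    (h : ∀ l t : ℝ, 0 < l → 0 < t → ENNReal.ofReal t < M l →
      ENNReal.ofReal l ≤ C * potentialBound σ N t) :
    ∫⁻ l in Ioi (0 : ℝ), ENNReal.ofReal l ^ (Q - 1) * M l ^ (Q * (a - σ)) ≤
      (C * hardyConst σ a) ^ Q *
        ∫⁻ l in Ioi (0 : ℝ), ENNReal.ofReal l ^ (Q - 1) * N l ^ (Q * a) := by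
  have hQ0 : 0 < Q := by linarith
  have hb : 0 < Q * (a - σ) := mul_pos hQ0 (by linarith)
  have hb' : 0 < Q * a := mul_pos hQ0 (by linarith)
  have hle : Q * (a - σ) ≤ Q * a := by gcongr; linarith
  have hb0 : ENNReal.ofReal (Q * (a - σ)) ≠ 0 := by simpa using hb
  calc ∫⁻ l in Ioi (0 : ℝ), ENNReal.ofReal l ^ (Q - 1) * M l ^ (Q * (a - σ))
      = ENNReal.ofReal (Q * (a - σ)) *
        ((∫⁻ l in Ioi (0 : ℝ), ENNReal.ofReal l ^ (Q - 1) * M l ^ (Q * (a - σ))) /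
          ENNReal.ofReal (Q * (a - σ))) := (ENNReal.mul_div_cancel hb0 (by simp)).symm
    _ ≤ ENNReal.ofReal (Q * a) * ((∫⁻ t in Ioi (0 : ℝ), ENNReal.ofReal t ^ (Q * (a - σ) - 1) *
          (C * potentialBound σ N t) ^ Q) / ENNReal.ofReal Q) := by
        gcongr ?_ * ?_
        · exact ENNReal.ofReal_le_ofReal hle
        exact lintegral_rpow_distribution_le hb hQ0 hM h
    _ = ENNReal.ofReal (Q * a) * (C ^ Q * (∫⁻ t in Ioi (0 : ℝ),
          ENNReal.ofReal t ^ (Q * (a - σ) - 1) * potentialBound σ N t ^ Q) /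
            ENNReal.ofReal Q) := by
        rw [← lintegral_const_mul' _ _ (by finiteness)]
        simp_rw [ENNReal.mul_rpow_of_nonneg _ _ hQ0.le, mul_left_comm]
    _ ≤ ENNReal.ofReal (Q * a) * (C ^ Q * (hardyConst σ a ^ Q * ∫⁻ t in Ioi (0 : ℝ),
          ENNReal.ofReal t ^ (Q * a - 1) * decrRearr N t ^ Q) / ENNReal.ofReal Q) := by
        gcongr
        exact lintegral_potentialBound_rpow_le hσ hQ hN hfin
    _ = (C * hardyConst σ a) ^ Q * (ENNReal.ofReal (Q * a) * ((∫⁻ t in Ioi (0 : ℝ),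
          ENNReal.ofReal t ^ (Q * a - 1) * decrRearr N t ^ Q) / ENNReal.ofReal Q)) := by
        rw [ENNReal.mul_rpow_of_nonneg _ _ hQ0.le]
        simp only [div_eq_mul_inv]
        ring
    _ ≤ (C * hardyConst σ a) ^ Q * (ENNReal.ofReal (Q * a) * ((∫⁻ l in Ioi (0 : ℝ),
          ENNReal.ofReal l ^ (Q - 1) * N l ^ (Q * a)) / ENNReal.ofReal (Q * a))) := by
        gcongr _ * (_ * ?_)
        exact lintegral_decrRearr_rpow_le hb' hQ0 hN
    _ = _ := by rw [ENNReal.mul_div_cancel (by simpa using hb') (by simp)]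

/-- Real interpolation for distribution functions, weak-type form. -/
lemma mul_rpow_le_of_potentialBound {σ a : ℝ} (hσ : σ < 1) (ha : 0 < a) (hσa : σ < a)
    {M N : ℝ → ℝ≥0∞} (hN : Antitone N)
    (hfin : ∀ l, 0 < l → N l ≠ ⊤) {C A : ℝ≥0∞}
    (hA : ∀ l, 0 < l → ENNReal.ofReal l * N l ^ a ≤ A)
    (h : ∀ l t : ℝ, 0 < l → 0 < t → ENNReal.ofReal t < M l →
      ENNReal.ofReal l ≤ C * potentialBound σ N t) {l : ℝ} (hl : 0 < l) :
    ENNReal.ofReal l * M l ^ (a - σ) ≤ C * hardyConst σ a * A := by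
  have hd : ∀ u : ℝ, 0 < u → decrRearr N u ≤ A * ENNReal.ofReal u ^ (-a) := fun u hu => by
    have hu0 : ENNReal.ofReal u ^ a ≠ 0 := by simp [hu]
    refine le_of_forall_lt_imp_le_of_dense fun k hk => ?_
    have hk' : k = ENNReal.ofReal k.toReal := (ENNReal.ofReal_toReal hk.ne_top).symm
    have hkt := hk.ne_top
    rcases eq_or_ne k 0 with rfl | hk0
    · simp
    rw [hk'] at hk ⊢
    rw [ENNReal.rpow_neg, ← div_eq_mul_inv,
      ENNReal.le_div_iff_mul_le (.inl hu0) (.inl (by finiteness))]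
    refine le_trans ?_ (hA _ (ENNReal.toReal_pos hk0 hkt))
    gcongr
    exact (lt_of_lt_decrRearr hN hk).le
  have hbound : ∀ t : ℝ, 0 < t → ENNReal.ofReal t < M l →
      ENNReal.ofReal l * ENNReal.ofReal t ^ (a - σ) ≤ C * hardyConst σ a * A := fun t ht htM => by
    have ht0 : ENNReal.ofReal t ≠ 0 := by simpa using ht
    have hΦ : potentialBound σ N t ≤ ENNReal.ofReal t ^ (σ - a) * (hardyConst σ a * A) := by
      calc potentialBound σ N t ≤ ENNReal.ofReal t ^ σ *
            ∫⁻ v in Ioi (0 : ℝ), hardyKernel σ v * decrRearr N (t * v) :=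
            potentialBound_le hσ hN hfin ht
        _ ≤ ENNReal.ofReal t ^ σ * ∫⁻ v in Ioi (0 : ℝ),
            (hardyKernel σ v * ENNReal.ofReal v ^ (-a)) * (A * ENNReal.ofReal t ^ (-a)) := by
            gcongr ENNReal.ofReal t ^ σ * ?_
            refine setLIntegral_mono' measurableSet_Ioi fun v (hv : 0 < v) => ?_
            calc _ ≤ hardyKernel σ v * (A * ENNReal.ofReal (t * v) ^ (-a)) := by
                  gcongr
                  exact hd _ (by positivity)
              _ = _ := by
                  rw [ENNReal.ofReal_mul ht.le, ENNReal.mul_rpow_of_ne_top (by simp) (by simp)]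
                  ring
        _ = _ := by
            have := measurable_hardyKernel σ
            rw [lintegral_mul_const _ (by fun_prop), ← hardyConst, sub_eq_add_neg σ a,
              ENNReal.rpow_add _ _ ht0 (by simp)]
            ring
    calc _ ≤ C * (ENNReal.ofReal t ^ (σ - a) * (hardyConst σ a * A)) *
          ENNReal.ofReal t ^ (a - σ) := by
          gcongr
          exact (h l t hl ht htM).trans (by gcongr)
      _ = (ENNReal.ofReal t ^ (σ - a) * ENNReal.ofReal t ^ (a - σ)) *
          (C * hardyConst σ a * A) := by ring
      _ = _ := by
          rw [← ENNReal.rpow_add _ _ ht0 (by simp)]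
          simp
  have hcont : Continuous fun m : ℝ≥0∞ => ENNReal.ofReal l * m ^ (a - σ) :=
    (ENNReal.continuous_const_mul (by simp)).comp ENNReal.continuous_rpow_const
  rcases eq_or_ne (M l) 0 with h0 | h0
  · simp [h0, ENNReal.zero_rpow_of_pos (sub_pos.2 hσa)]
  have := (nhdsWithin_Iio_neBot' ⟨0, pos_iff_ne_zero.2 h0⟩ le_rfl :
    (nhdsWithin (M l) (Iio (M l))).NeBot)
  refine le_of_tendsto (hcont.continuousWithinAt (s := Iio (M l)) (x := M l))
    (eventually_mem_nhdsWithin.mono fun m hm => ?_)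
  rcases eq_or_ne m 0 with rfl | hm0
  · simp [ENNReal.zero_rpow_of_pos (sub_pos.2 hσa)]
  have hm' : m = ENNReal.ofReal m.toReal := (ENNReal.ofReal_toReal (ne_top_of_lt hm)).symm
  rw [hm']
  exact hbound _ (ENNReal.toReal_pos hm0 (ne_top_of_lt hm)) (hm' ▸ hm)

/-- The kernel of the Riesz potential of order `s` on `ℝ^d`. -/
noncomputable def rieszKernel (d : ℕ) (s : ℝ) (x y : EuclideanSpace ℝ (Fin d)) : ℝ≥0∞ :=
  ENNReal.ofReal (‖x - y‖ ^ (s - (d : ℝ)))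

lemma measurable_rieszKernel (d : ℕ) (s : ℝ) :
    Measurable fun z : EuclideanSpace ℝ (Fin d) × EuclideanSpace ℝ (Fin d) =>
      rieszKernel d s z.1 z.2 := by
  unfold rieszKernel
  fun_prop

lemma rieszKernel_comm (d : ℕ) (s : ℝ) (x y : EuclideanSpace ℝ (Fin d)) :
    rieszKernel d s x y = rieszKernel d s y x := by
  rw [rieszKernel, rieszKernel, norm_sub_rev]

lemma volume_rieszKernel_superlevel_le {d : ℕ} {s : ℝ} (hsd : s < d)
    (x : EuclideanSpace ℝ (Fin d)) {τ : ℝ} (hτ : 0 < τ) :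
    volume {y | τ < ‖x - y‖ ^ (s - (d : ℝ))} ≤
      ENNReal.ofReal (τ ^ (-((d : ℝ) / (d - s)))) *
        volume (Metric.ball (0 : EuclideanSpace ℝ (Fin d)) 1) := by
  have hds : s - (d : ℝ) < 0 := by linarith
  have hsub : {y | τ < ‖x - y‖ ^ (s - (d : ℝ))} ⊆ Metric.ball x (τ ^ (1 / (s - (d : ℝ)))) := by
    intro y hy
    replace hy : τ < ‖x - y‖ ^ (s - (d : ℝ)) := hy
    have hxy : 0 < ‖x - y‖ := by
      by_contra! h
      rw [le_antisymm h (norm_nonneg _), Real.zero_rpow hds.ne] at hy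
      linarith
    rw [mem_ball_iff_norm', one_div]
    have := Real.rpow_lt_rpow_of_neg hτ hy (inv_lt_zero.2 hds)
    rwa [← Real.rpow_mul hxy.le, mul_inv_cancel₀ hds.ne, Real.rpow_one] at this
  refine (measure_mono hsub).trans_eq ?_
  rw [Measure.addHaar_ball_of_pos _ _ (Real.rpow_pos_of_pos hτ _), finrank_euclideanSpace_fin,
    ← Real.rpow_natCast, ← Real.rpow_mul hτ.le]
  congr 3
  have h1 : s - (d : ℝ) ≠ 0 := hds.ne
  have h2 : (d : ℝ) - s ≠ 0 := by linarith
  field_simp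
  ring

/-- The constant in the bound of a Riesz potential of an indicator function. -/
noncomputable def rieszConst (d : ℕ) (s : ℝ) : ℝ≥0∞ :=
  1 + volume (Metric.ball (0 : EuclideanSpace ℝ (Fin d)) 1) *
    ENNReal.ofReal (1 / ((d : ℝ) / (d - s) - 1))

lemma rieszConst_ne_top (d : ℕ) (s : ℝ) : rieszConst d s ≠ ⊤ := by
  have : volume (Metric.ball (0 : EuclideanSpace ℝ (Fin d)) 1) ≠ ⊤ := measure_ball_lt_top.ne
  unfold rieszConst
  finiteness

lemma setLIntegral_rieszKernel_le {d : ℕ} {s : ℝ} (hs0 : 0 < s) (hsd : s < d)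
    (x : EuclideanSpace ℝ (Fin d)) (E : Set (EuclideanSpace ℝ (Fin d))) :
    ∫⁻ y in E, rieszKernel d s x y ≤ rieszConst d s * volume E ^ (s / d) := by
  have hd : (0 : ℝ) < d := hs0.trans hsd
  have hσ : 0 < s / d := by positivity
  rcases eq_or_ne (volume E) 0 with h0 | h0
  · simp [Measure.restrict_eq_zero.2 h0]
  rcases eq_or_ne (volume E) ⊤ with h1 | h1
  · simp [h1, ENNReal.top_rpow_of_pos hσ, rieszConst]
  set ω := volume (Metric.ball (0 : EuclideanSpace ℝ (Fin d)) 1)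
  set m : ℝ := (d : ℝ) / (d - s) with hm
  have hm1 : 1 < m := by rw [hm, one_lt_div (by linarith)]; linarith
  set ε := (volume E).toReal
  have hε0 : 0 < ε := ENNReal.toReal_pos h0 h1
  have hEε : volume E = ENNReal.ofReal ε := (ENNReal.ofReal_toReal h1).symm
  set τ₀ : ℝ := ε ^ (s / d - 1) with hτ₀
  have hτ₀pos : 0 < τ₀ := Real.rpow_pos_of_pos hε0 _
  have hlow : ∫⁻ τ in Ioc 0 τ₀, volume.restrict E {y | τ < ‖x - y‖ ^ (s - (d : ℝ))} ≤
      ENNReal.ofReal (ε ^ (s / d)) := by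
    calc _ ≤ ∫⁻ τ in Ioc 0 τ₀, volume E := by
          exact lintegral_mono fun τ =>
            (measure_mono (subset_univ _)).trans_eq (Measure.restrict_apply_univ E)
      _ = ENNReal.ofReal (ε * τ₀) := by
          rw [setLIntegral_const, Real.volume_Ioc, sub_zero, hEε, ← ENNReal.ofReal_mul hε0.le]
      _ = _ := by
          congr 1
          conv_lhs => rw [hτ₀, ← Real.rpow_one ε, ← Real.rpow_mul hε0.le, one_mul,
            ← Real.rpow_add hε0, add_sub_cancel]
  have hhigh : ∫⁻ τ in Ioi τ₀, volume.restrict E {y | τ < ‖x - y‖ ^ (s - (d : ℝ))} ≤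
      ω * ENNReal.ofReal (1 / (m - 1)) * ENNReal.ofReal (ε ^ (s / d)) := by
    calc _ ≤ ∫⁻ τ in Ioi τ₀, ENNReal.ofReal (τ ^ (-m)) * ω := by
          refine setLIntegral_mono' measurableSet_Ioi fun τ (hτ : τ₀ < τ) => ?_
          exact (Measure.restrict_apply_le _ _).trans
            (volume_rieszKernel_superlevel_le hsd x (hτ₀pos.trans hτ))
      _ = ENNReal.ofReal (τ₀ ^ (1 - m) / (m - 1)) * ω := by
          rw [lintegral_mul_const _ (by fun_prop), ← ofReal_integral_eq_lintegral_ofReal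
            (integrableOn_Ioi_rpow_of_lt (by linarith) hτ₀pos)
            ((ae_restrict_iff' measurableSet_Ioi).2 (.of_forall fun t (ht : τ₀ < t) =>
              Real.rpow_nonneg (hτ₀pos.trans ht).le _)),
            integral_Ioi_rpow_of_lt (by linarith) hτ₀pos]
          congr 2
          rw [show -m + 1 = -(m - 1) by ring, neg_div_neg_eq, neg_sub]
      _ = _ := by
          have : τ₀ ^ (1 - m) = ε ^ (s / d) := by
            rw [hτ₀, ← Real.rpow_mul hε0.le]
            congr 1
            have : (d : ℝ) - s ≠ 0 := by linarith
            rw [hm]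
            field_simp
            ring
          rw [this, div_eq_mul_one_div, ENNReal.ofReal_mul (by positivity)]
          ring
  calc ∫⁻ y in E, rieszKernel d s x y
      = ∫⁻ τ in Ioi 0, volume.restrict E {y | τ < ‖x - y‖ ^ (s - (d : ℝ))} :=
        lintegral_eq_lintegral_meas_lt _ (.of_forall fun y => by positivity)
          (Measurable.aemeasurable (by fun_prop))
    _ = _ := by
        rw [← Ioc_union_Ioi_eq_Ioi hτ₀pos.le,
          lintegral_union measurableSet_Ioi (Ioc_disjoint_Ioi le_rfl)]
    _ ≤ _ := add_le_add hlow hhigh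
    _ = _ := by
        rw [rieszConst, hEε, ENNReal.ofReal_rpow_of_pos hε0]
        ring

lemma setLIntegral_setLIntegral_rieszKernel_le {d : ℕ} {s : ℝ} (hs0 : 0 < s) (hsd : s < d)
    (A E : Set (EuclideanSpace ℝ (Fin d))) :
    ∫⁻ y in E, ∫⁻ x in A, rieszKernel d s x y ≤
      rieszConst d s * min (volume A * volume E ^ (s / d)) (volume E * volume A ^ (s / d)) := by
  rw [mul_min]
  refine le_min ?_ ?_
  · rw [lintegral_lintegral_swap (by
      exact ((measurable_rieszKernel d s).comp measurable_swap).aemeasurable)]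
    refine (lintegral_mono fun x => setLIntegral_rieszKernel_le hs0 hsd x E).trans_eq ?_
    rw [setLIntegral_const]
    ring
  · simp_rw [fun x y => rieszKernel_comm d s x y]
    refine (lintegral_mono fun y => setLIntegral_rieszKernel_le hs0 hsd y A).trans_eq ?_
    rw [setLIntegral_const]
    ring

lemma setLIntegral_rieszPotential_le {d : ℕ} {s : ℝ} (hs0 : 0 < s) (hsd : s < d)
    {f : EuclideanSpace ℝ (Fin d) → ℂ} (hf : Measurable f)
    (A : Set (EuclideanSpace ℝ (Fin d))) :
    ∫⁻ x in A, ∫⁻ y, rieszKernel d s x y * ‖f y‖ₑ ≤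
      rieszConst d s * ∫⁻ l in Ioi (0 : ℝ), min (volume A * volume {y | l < ‖f y‖} ^ (s / d))
        (volume {y | l < ‖f y‖} * volume A ^ (s / d)) := by
  have hK := measurable_rieszKernel d s
  have hW : Measurable fun y => ∫⁻ x in A, rieszKernel d s x y :=
    Measurable.lintegral_prod_left' hK
  calc ∫⁻ x in A, ∫⁻ y, rieszKernel d s x y * ‖f y‖ₑ
      = ∫⁻ y, (∫⁻ x in A, rieszKernel d s x y) * ‖f y‖ₑ := by
        rw [lintegral_lintegral_swap (Measurable.aemeasurable (by fun_prop))]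
        exact lintegral_congr fun y => lintegral_mul_const _ (by fun_prop)
    _ = ∫⁻ y, ENNReal.ofReal ‖f y‖ ∂(volume.withDensity
          fun y => ∫⁻ x in A, rieszKernel d s x y) := by
        rw [lintegral_withDensity_eq_lintegral_mul _ hW (by fun_prop)]
        simp
    _ = ∫⁻ l in Ioi (0 : ℝ), ∫⁻ y in {y | l < ‖f y‖}, ∫⁻ x in A, rieszKernel d s x y := by
        rw [lintegral_eq_lintegral_meas_lt _ (.of_forall fun y => norm_nonneg _)
          hf.norm.aemeasurable]
        exact lintegral_congr fun l =>
          withDensity_apply _ (measurableSet_lt measurable_const hf.norm)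
    _ ≤ ∫⁻ l in Ioi (0 : ℝ), rieszConst d s *
          min (volume A * volume {y | l < ‖f y‖} ^ (s / d))
            (volume {y | l < ‖f y‖} * volume A ^ (s / d)) :=
        lintegral_mono fun l => setLIntegral_setLIntegral_rieszKernel_le hs0 hsd A _
    _ = _ := lintegral_const_mul' _ _ (rieszConst_ne_top d s)

lemma le_potentialBound_of_enorm_le_rieszPotential {d : ℕ} {s : ℝ} (hs0 : 0 < s) (hsd : s < d)
    {f g : EuclideanSpace ℝ (Fin d) → ℂ} (hf : Measurable f) {c : ℝ≥0∞}
    (hg : ∀ x, ‖g x‖ₑ ≤ c * ∫⁻ y, rieszKernel d s x y * ‖f y‖ₑ) {l t : ℝ}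
    (hlt : ENNReal.ofReal t < volume {x | l < ‖g x‖}) :
    ENNReal.ofReal l ≤ c * rieszConst d s *
      potentialBound (s / d) (fun l => volume {y | l < ‖f y‖}) t := by
  have hK := measurable_rieszKernel d s
  have hd : (0 : ℝ) < d := hs0.trans hsd
  have hG : Measurable fun x => ∫⁻ y, rieszKernel d s x y * ‖f y‖ₑ :=
    Measurable.lintegral_prod_right'
      (f := fun z : EuclideanSpace ℝ (Fin d) × EuclideanSpace ℝ (Fin d) =>
        rieszKernel d s z.1 z.2 * ‖f z.2‖ₑ) (by fun_prop)
  set B := {x | ENNReal.ofReal l ≤ c * ∫⁻ y, rieszKernel d s x y * ‖f y‖ₑ}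
  have hBm : MeasurableSet B := measurableSet_le measurable_const (hG.const_mul c)
  have hsub : {x | l < ‖g x‖} ⊆ B := fun x hx =>
    (ENNReal.ofReal_le_ofReal (le_of_lt hx)).trans
      ((ofReal_norm (g x)).trans_le (hg x))
  obtain ⟨A, hAm, hAB, htA, hA⟩ :=
    Measure.exists_subset_measure_lt_top hBm (hlt.trans_le (measure_mono hsub))
  have hA0 : volume A ≠ 0 := (bot_le.trans_lt htA).ne'
  have hpow : volume A ^ (s / d) ≤ volume A * ENNReal.ofReal t ^ (s / d - 1) := by
    calc volume A ^ (s / d) = volume A * volume A ^ (s / d - 1) := by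
          conv_rhs => rw [← ENNReal.rpow_one (volume A), ← ENNReal.rpow_mul, one_mul,
            ← ENNReal.rpow_add _ _ hA0 hA.ne, add_sub_cancel]
      _ ≤ _ := by
          gcongr _ * ?_
          refine rpow_le_rpow_of_exponent_nonpos ?_ htA.le
          rw [sub_nonpos, div_le_one hd]
          exact hsd.le
  refine (ENNReal.mul_le_mul_iff_right hA0 hA.ne).1 ?_
  calc volume A * ENNReal.ofReal l = ∫⁻ _ in A, ENNReal.ofReal l := by
        rw [setLIntegral_const, mul_comm]
    _ ≤ ∫⁻ x in A, c * ∫⁻ y, rieszKernel d s x y * ‖f y‖ₑ := setLIntegral_mono' hAm hAB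
    _ = c * ∫⁻ x in A, ∫⁻ y, rieszKernel d s x y * ‖f y‖ₑ := lintegral_const_mul _ hG
    _ ≤ c * (rieszConst d s * ∫⁻ l in Ioi (0 : ℝ),
          min (volume A * volume {y | l < ‖f y‖} ^ (s / d))
            (volume {y | l < ‖f y‖} * volume A ^ (s / d))) := by
        gcongr
        exact setLIntegral_rieszPotential_le hs0 hsd hf A
    _ ≤ c * (rieszConst d s * ∫⁻ l in Ioi (0 : ℝ), volume A *
          min (volume {y | l < ‖f y‖} ^ (s / d))
            (volume {y | l < ‖f y‖} * ENNReal.ofReal t ^ (s / d - 1))) := by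
        gcongr with l
        rw [mul_min]
        refine min_le_min le_rfl ?_
        rw [mul_left_comm]
        gcongr
    _ = _ := by
        rw [lintegral_const_mul' _ _ hA.ne, potentialBound]
        ring

lemma antitone_distribution {α : Type*} [MeasurableSpace α] (μ : Measure α) (f : α → ℂ) :
    Antitone fun l : ℝ => μ {x | l < ‖f x‖} := fun _ _ h =>
  measure_mono fun _ hx => h.trans_lt hx

lemma lorentzNorm_of_ne_top {α : Type*} [MeasurableSpace α] (μ : Measure α) (p : ℝ) {q : ℝ≥0∞}
    (hq : q ≠ ⊤) (f : α → ℂ) :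
    lorentzNorm μ p q f = (∫⁻ l in Ioi (0 : ℝ), ENNReal.ofReal l ^ (q.toReal - 1) *
      μ {x | l < ‖f x‖} ^ (q.toReal * (1 / p))) ^ (1 / q.toReal) := by
  rw [lorentzNorm, if_neg hq]
  congr 1
  refine setLIntegral_congr_fun measurableSet_Ioi fun l (hl : 0 < l) => ?_
  have hl0 : ENNReal.ofReal l ≠ 0 := by simpa using hl
  rw [ENNReal.mul_rpow_of_nonneg _ _ toReal_nonneg, ← ENNReal.rpow_mul, mul_comm (1 / p),
    ENNReal.rpow_sub _ _ hl0 (by simp), ENNReal.rpow_one]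
  simp only [div_eq_mul_inv]
  ring

/-- **Sobolev embedding in Lorentz spaces** for functions dominated by a Riesz potential. -/
lemma lorentzNorm_le_of_enorm_le_rieszPotential {d : ℕ} {s : ℝ} (hs0 : 0 < s) (hsd : s < d)
    {p r : ℝ} (hp : 1 < p) (hr : 0 < r) (hscal : 1 / r = 1 / p - s / d) {q : ℝ≥0∞} (hq : 1 ≤ q)
    {f g : EuclideanSpace ℝ (Fin d) → ℂ} (hf : Measurable f)
    (hfin : ∀ l, 0 < l → volume {y | l < ‖f y‖} ≠ ⊤) {c : ℝ≥0∞} (hc : c ≠ ⊤)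
    (hg : ∀ x, ‖g x‖ₑ ≤ c * ∫⁻ y, rieszKernel d s x y * ‖f y‖ₑ) :
    lorentzNorm volume r q g ≤
      c * rieszConst d s * hardyConst (s / d) (1 / p) * lorentzNorm volume p q f := by
  have hd : (0 : ℝ) < d := hs0.trans hsd
  have hσ : s / d < 1 := (div_lt_one hd).2 hsd
  have hr' : 0 < 1 / r := by positivity
  have hσp : s / d < 1 / p := by linarith
  have hC : c * rieszConst d s ≠ ⊤ := ENNReal.mul_ne_top hc (rieszConst_ne_top d s)
  have hN := antitone_distribution volume f
  have hM := antitone_distribution volume g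
  have key := fun (l t : ℝ) (_ : 0 < l) (_ : 0 < t)
    (hlt : ENNReal.ofReal t < volume {x | l < ‖g x‖}) =>
    le_potentialBound_of_enorm_le_rieszPotential hs0 hsd hf hg hlt
  rcases eq_or_ne q ⊤ with rfl | hq'
  · simp only [lorentzNorm, if_true]
    refine iSup₂_le fun l hl => ?_
    rw [hscal]
    exact mul_rpow_le_of_potentialBound hσ (by positivity) hσp hN hfin
      (fun l hl => le_iSup₂_of_le l hl le_rfl) key hl
  · have hQ : 1 ≤ q.toReal := by simpa using ENNReal.toReal_mono hq' hq
    have hQ0 : 0 < q.toReal := by linarith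
    rw [lorentzNorm_of_ne_top _ _ hq', lorentzNorm_of_ne_top _ _ hq', hscal]
    refine (ENNReal.rpow_le_rpow (lintegral_rpow_le_of_potentialBound (by positivity) hσ hσp hQ
      hM hN hfin hC key) (by positivity)).trans_eq ?_
    rw [ENNReal.mul_rpow_of_nonneg _ _ (by positivity), ← ENNReal.rpow_mul,
      mul_one_div_cancel hQ0.ne', ENNReal.rpow_one]

/-- Lorentz-space Sobolev embedding. For `0 < s < d`, `1 < p < r < ∞` with
`d/r = d/p − s`, `1 ≤ q ≤ ∞`, and Schwartz `f`, the Riesz potential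
`|∇|^{-s} f = c_{d,s} |x|^{s−d} ∗ f` satisfies `‖|∇|^{-s} f‖_{L^{r,q}} ≤ C ‖f‖_{L^{p,q}}`. -/
theorem lorentz_sobolev_embedding (d : ℕ) (hd : 1 ≤ d) (s : ℝ) (hs0 : 0 < s) (hsd : s < d)
    (p r : ℝ) (hp : 1 < p) (hpr : p < r)
    (hscal : (d : ℝ) / r = (d : ℝ) / p - s) (q : ℝ≥0∞) (hq : 1 ≤ q) (c : ℝ) :
    ∃ C : ℝ, 0 < C ∧ ∀ f : SchwartzMap (EuclideanSpace ℝ (Fin d)) ℂ,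
      lorentzNorm volume r q
          (fun x => ∫ y, ((c * ‖x - y‖ ^ (s - (d : ℝ)) : ℝ) : ℂ) * f y) ≤
        ENNReal.ofReal C * lorentzNorm volume p q (fun x => f x) := by
  have hd0 : (0 : ℝ) < d := hs0.trans hsd
  have hp0 : 0 < p := by linarith
  have hr0 : 0 < r := hp0.trans hpr
  have hscal' : 1 / r = 1 / p - s / d := by
    field_simp at hscal ⊢
    linarith
  have hσp : s / d < 1 / p := by
    have : 0 < 1 / r := by positivity
    linarith
  have hp1 : 1 / p < 1 := (div_lt_one hp0).2 hp
  set C₀ := ENNReal.ofReal |c| * rieszConst d s * hardyConst (s / d) (1 / p)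
  have hC₀t : C₀ ≠ ⊤ := ENNReal.mul_ne_top
    (ENNReal.mul_ne_top ENNReal.ofReal_ne_top (rieszConst_ne_top d s)) (hardyConst_ne_top hp1 hσp)
  refine ⟨C₀.toReal + 1, by positivity, fun f => ?_⟩
  have hle : C₀ ≤ ENNReal.ofReal (C₀.toReal + 1) := by
    rw [ENNReal.le_ofReal_iff_toReal_le hC₀t (by positivity)]
    linarith
  refine le_trans ?_ (mul_le_mul_left hle _)
  refine lorentzNorm_le_of_enorm_le_rieszPotential hs0 hsd hp hr0 hscal' hq
    f.continuous.measurable (fun l hl => (f.integrable.measure_norm_gt_lt_top hl).ne)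
    ENNReal.ofReal_ne_top fun x => ?_
  refine (enorm_integral_le_lintegral_enorm _).trans_eq ?_
  rw [← lintegral_const_mul' _ _ ENNReal.ofReal_ne_top]
  refine lintegral_congr fun y => ?_
  rw [enorm_mul, ← mul_assoc, rieszKernel, ← ENNReal.ofReal_mul (abs_nonneg c),
    ← ofReal_norm, Complex.norm_real, Real.norm_eq_abs, abs_mul,
    abs_of_nonneg (Real.rpow_nonneg (norm_nonneg (x - y)) _)]
end
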